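/- arXiv:1907.01315 — 2 statements merged into one kernel-verified Lean document; each statement's English description precedes it below -/
import Mathlib

section
/- Let I be a relative good ideal of a local good semigroup S ⊆ ℕ², and let A ⊆ I be such that there exists c ∈ ℕ² with c+ℕ² ⊆ ℕ²∖A and such that E = I∖A is a relative good ideal of S. Then NL(A) = d(I∖E). -/
/-- The ambient space `ℤ²`; `ℕ²` is identified with the nonnegative orthant. -/
abbrev Z2 : Type := ℤ × ℤ

/-- The nonnegative orthant, representing `ℕ² ⊆ ℤ²`. -/
def orth : Set Z2 := {a : Z2 | 0 ≤ a.1 ∧ 0 ≤ a.2}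

/-- Property (G1): closure under componentwise minimum. -/
def MinClosed (E : Set Z2) : Prop := ∀ a ∈ E, ∀ b ∈ E, a ⊓ b ∈ E

/-- Property (G3). -/
def G3P (E : Set Z2) : Prop :=
  ∀ a ∈ E, ∀ b ∈ E, a ≠ b →
    (a.1 = b.1 →
      ∃ e ∈ E, a.1 < e.1 ∧ min a.2 b.2 ≤ e.2 ∧ (a.2 ≠ b.2 → e.2 = min a.2 b.2)) ∧
    (a.2 = b.2 →
      ∃ e ∈ E, a.2 < e.2 ∧ min a.1 b.1 ≤ e.1 ∧ (a.1 ≠ b.1 → e.1 = min a.1 b.1))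

/-- A good semigroup of `ℕ²` (viewed inside `ℤ²`). -/
def IsGood (S : Set Z2) : Prop :=
  S ⊆ orth ∧ (0 : Z2) ∈ S ∧ (∀ a ∈ S, ∀ b ∈ S, a + b ∈ S) ∧
  MinClosed S ∧ (∃ δ : Z2, ∀ y : Z2, δ ≤ y → y ∈ S) ∧ G3P S

/-- A good semigroup is local if its only element with a zero coordinate is `0`. -/
def IsLocal (S : Set Z2) : Prop := ∀ a ∈ S, (a.1 = 0 ∨ a.2 = 0) → a = 0

/-- A relative good ideal of `S`. -/
def IsRelGoodIdeal (S E : Set Z2) : Prop :=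
  E.Nonempty ∧ (∀ e ∈ E, ∀ s ∈ S, e + s ∈ E) ∧ (∃ a ∈ S, ∀ e ∈ E, a + e ∈ S) ∧
  MinClosed E ∧ G3P E

/-- A saturated chain of length `n` in `E`. -/
def IsSatChain (E : Set Z2) (n : ℕ) (f : ℕ → Z2) : Prop :=
  (∀ i ≤ n, f i ∈ E) ∧ (∀ i < n, f i < f (i + 1)) ∧
  (∀ i < n, ∀ c ∈ E, ¬ (f i < c ∧ c < f (i + 1)))

/-- `d_E(a,b)`: the common length of all saturated chains in `E` from `a` to `b`. -/
noncomputable def chainDist (E : Set Z2) (a b : Z2) : ℕ :=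
  sSup {n : ℕ | ∃ f : ℕ → Z2, IsSatChain E n f ∧ f 0 = a ∧ f n = b}

/-- The (componentwise) minimal element `e(E)` of `E`. -/
noncomputable def minEl (E : Set Z2) : Z2 :=
  (sInf (Prod.fst '' E), sInf (Prod.snd '' E))

/-- The distance `d(E∖F)` between `F ⊆ E`: the common value of
`d_E(e(E),α) - d_F(e(F),α)` for all sufficiently large `α ∈ F`. -/
noncomputable def dist2 (E F : Set Z2) : ℤ :=
  sSup {z : ℤ | ∃ β : Z2, ∀ α ∈ F, β ≤ α →
    (chainDist E (minEl E) α : ℤ) - (chainDist F (minEl F) α : ℤ) = z}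

/-- The conductor `c(E)`: the componentwise minimal `δ` with `δ + ℕ² ⊆ E`. -/
noncomputable def condE (E : Set Z2) : Z2 :=
  (sInf ((fun δ : Z2 => δ.1) '' {δ : Z2 | ∀ y : Z2, δ ≤ y → y ∈ E}),
   sInf ((fun δ : Z2 => δ.2) '' {δ : Z2 | ∀ y : Z2, δ ≤ y → y ∈ E}))

/-- The conductor ideal `C(E) = {β ∈ E : β ≥ c(E)}`. -/
noncomputable def CIdeal (E : Set Z2) : Set Z2 := {b ∈ E | condE E ≤ b}

/-- The length `l(E) = d(E ∖ C(E))`. -/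
noncomputable def glen (E : Set Z2) : ℤ := dist2 E (CIdeal E)

/-- The genus `g(E) = d(ℕ² ∖ E)`. -/
noncomputable def genus (E : Set Z2) : ℤ := dist2 orth E

/-- The good semigroup `ℕ²(1,1) = {0} ∪ ((1,1) + ℕ²)`. -/
def N2oneone : Set Z2 := {a : Z2 | a = 0 ∨ ((1 : ℤ), (1 : ℤ)) ≤ a}
/-- `a ≪ b`: both coordinates strictly smaller. -/
def llt (a b : Z2) : Prop := a.1 < b.1 ∧ a.2 < b.2

/-- `B`: the elements of `R` that are maximal with respect to `≤≤`. -/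
def Bof (R : Set Z2) : Set Z2 := {a ∈ R | ∀ b ∈ R, ¬ llt a b}

/-- `C`: the elements of `B` expressible as the componentwise minimum of two
other elements of `B`. -/
def Cof (B : Set Z2) : Set Z2 :=
  {a ∈ B | ∃ b ∈ B, ∃ c ∈ B, b ≠ a ∧ c ≠ a ∧ a = b ⊓ c}

/-- One step of the level construction: `D = B ∖ C`. -/
def Dof (R : Set Z2) : Set Z2 := Bof R \ Cof (Bof R)

/-- `NLrem A i = D^(1) ∪ ⋯ ∪ D^(i)`: the union of the first `i` levels of `A`. -/
def NLrem (A : Set Z2) : ℕ → Set Z2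
  | 0 => ∅
  | i + 1 => NLrem A i ∪ Dof (A \ NLrem A i)

/-- `NL(A)`: the number of levels of `A`, i.e. the least `N` with
`A = D^(1) ∪ ⋯ ∪ D^(N)`. -/
noncomputable def NL (A : Set Z2) : ℕ := sInf {N : ℕ | A ⊆ NLrem A N}

/-- The pseudo-Frobenius elements `PF(S) = {α ∈ ℕ²∖S : α + M ⊆ S}`. -/
def PFset (S : Set Z2) : Set Z2 :=
  {a : Z2 | a ∈ orth ∧ a ∉ S ∧ ∀ m ∈ S, m ≠ 0 → a + m ∈ S}

/-- The type `t(S) = NL(PF(S))`. -/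
noncomputable def typ (S : Set Z2) : ℕ := NL (PFset S)

/-- `E` has a point on the vertical half-line going up from `(x, y)`. -/
def VHit (E : Set Z2) (x y : ℤ) : Prop := ∃ t, y ≤ t ∧ (x, t) ∈ E

/-- `E` has a point on the horizontal half-line going right from `(x, y)`. -/
def HHit (E : Set Z2) (x y : ℤ) : Prop := ∃ s, x ≤ s ∧ (s, y) ∈ E

open Classical in
/-- The integer indicator of a proposition. -/
noncomputable def ind (P : Prop) : ℤ := if P then 1 else 0

theorem ind_true {P : Prop} (h : P) : ind P = 1 := by simp [ind, h]

theorem ind_false {P : Prop} (h : ¬ P) : ind P = 0 := by simp [ind, h]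

theorem ind_mono {P Q : Prop} (h : P → Q) : ind P ≤ ind Q := by
  by_cases hP : P
  · rw [ind_true hP, ind_true (h hP)]
  · by_cases hQ : Q <;> simp [ind, hP, hQ]

theorem ind_nonneg (P : Prop) : 0 ≤ ind P := by
  by_cases hP : P <;> simp [ind, hP]

theorem MinClosed.mk_mem {E : Set Z2} (hE : MinClosed E) {x y s t : ℤ}
    (hv : (x, t) ∈ E) (hh : (s, y) ∈ E) (hxs : x ≤ s) (hyt : y ≤ t) : (x, y) ∈ E := by
  have h := hE _ hv _ hh
  simpa [hxs, hyt] using h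

/-- The two ways around a unit square meet the same number of occupied half-lines. -/
theorem G3P.square {E : Set Z2} (hG : G3P E) (x y : ℤ) :
    ind (VHit E x y) + ind (HHit E (x + 1) y) = ind (HHit E x y) + ind (VHit E x (y + 1)) := by
  by_cases hp : (x, y) ∈ E
  · rw [ind_true (P := VHit E x y) ⟨y, le_rfl, hp⟩, ind_true (P := HHit E x y) ⟨x, le_rfl, hp⟩]
    congr 2
    apply propext
    constructor
    · rintro ⟨s, hs, hsE⟩
      obtain ⟨e, heE, h1, -, h2⟩ :=
        (hG _ hp _ hsE (by simp only [ne_eq, Prod.mk.injEq, not_and]; omega)).2 rfl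
      have h3 : e.1 = x := by
        have := h2 (by change x ≠ s; omega)
        simp only at this
        omega
      exact ⟨e.2, h1, by rw [← h3]; exact heE⟩
    · rintro ⟨t, ht, htE⟩
      obtain ⟨e, heE, h1, -, h2⟩ :=
        (hG _ hp _ htE (by simp only [ne_eq, Prod.mk.injEq, not_and]; omega)).1 rfl
      have h3 : e.2 = y := by
        have := h2 (by change y ≠ t; omega)
        simp only at this
        omega
      exact ⟨e.1, h1, by rw [← h3]; exact heE⟩
  · have hV : VHit E x y ↔ VHit E x (y + 1) := by
      constructor
      · rintro ⟨t, ht, htE⟩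
        rcases ht.eq_or_lt with rfl | h
        · exact absurd htE hp
        · exact ⟨t, h, htE⟩
      · rintro ⟨t, ht, htE⟩
        exact ⟨t, by omega, htE⟩
    have hH : HHit E x y ↔ HHit E (x + 1) y := by
      constructor
      · rintro ⟨t, ht, htE⟩
        rcases ht.eq_or_lt with rfl | h
        · exact absurd htE hp
        · exact ⟨t, h, htE⟩
      · rintro ⟨t, ht, htE⟩
        exact ⟨t, by omega, htE⟩
    rw [hV, hH]
    ring

/-- The number of occupied half-lines met by the lattice path that goes from `g` to the right
and then up to `(x, y)`. -/
noncomputable def pathCount (E : Set Z2) (g : Z2) (x y : ℤ) : ℤ :=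
  ∑ s ∈ Finset.Ico g.1 x, ind (VHit E s g.2) + ∑ t ∈ Finset.Ico g.2 y, ind (HHit E x t)

theorem Int.sum_Ico_add_one {a b : ℤ} (h : a ≤ b) (f : ℤ → ℤ) :
    ∑ s ∈ Finset.Ico a (b + 1), f s = ∑ s ∈ Finset.Ico a b, f s + f b := by
  have : Finset.Ico a (b + 1) = insert b (Finset.Ico a b) := by
    ext z
    simp only [Finset.mem_Ico, Finset.mem_insert]
    omega
  rw [this, Finset.sum_insert (by simp)]
  ring

theorem pathCount_snd_add_one (E : Set Z2) (g : Z2) (x : ℤ) {y : ℤ} (hy : g.2 ≤ y) :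
    pathCount E g x (y + 1) = pathCount E g x y + ind (HHit E x y) := by
  rw [pathCount, Int.sum_Ico_add_one hy, pathCount]
  ring

theorem pathCount_fst_add_one {E : Set Z2} (hG : G3P E) {g : Z2} {x y : ℤ} (hx : g.1 ≤ x)
    (hy : g.2 ≤ y) :
    pathCount E g (x + 1) y = pathCount E g x y + ind (VHit E x y) := by
  induction y, hy using Int.leInduction with
  | base =>
    rw [pathCount, Int.sum_Ico_add_one hx, pathCount]
    simp
  | succ y hy ih =>
    rw [pathCount_snd_add_one _ _ _ hy, pathCount_snd_add_one _ _ _ hy, ih]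
    have := hG.square x y
    linarith

theorem pathCount_eq_of_not_VHit {E : Set Z2} (hG : G3P E) {g : Z2} {x x' y : ℤ} (hx : g.1 ≤ x)
    (hy : g.2 ≤ y) (hxx : x ≤ x') (h : ∀ s, x ≤ s → s < x' → ¬ VHit E s y) :
    pathCount E g x' y = pathCount E g x y := by
  induction x', hxx using Int.leInduction with
  | base => rfl
  | succ s hs ih =>
    rw [pathCount_fst_add_one hG (hx.trans hs) hy, ih fun u hu hus => h u hu (by omega),
      ind_false (h s hs (by omega)), add_zero]

theorem pathCount_eq_of_not_HHit {E : Set Z2} {g : Z2} {x y y' : ℤ}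
    (hy : g.2 ≤ y) (hyy : y ≤ y') (h : ∀ t, y ≤ t → t < y' → ¬ HHit E x t) :
    pathCount E g x y' = pathCount E g x y := by
  induction y', hyy using Int.leInduction with
  | base => rfl
  | succ s hs ih =>
    rw [pathCount_snd_add_one _ _ _ (hy.trans hs), ih fun u hu hus => h u hu (by omega),
      ind_false (h s hs (by omega)), add_zero]

/-- Passing to a consecutive element increases the path count by one. -/
theorem pathCount_of_consecutive {E : Set Z2} (hM : MinClosed E) (hG : G3P E) {g a b : Z2}
    (hga : g ≤ a) (ha : a ∈ E) (hb : b ∈ E) (hab : a < b)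
    (hcons : ∀ c ∈ E, ¬ (a < c ∧ c < b)) :
    pathCount E g b.1 b.2 = pathCount E g a.1 a.2 + 1 := by
  obtain ⟨a1, a2⟩ := a
  obtain ⟨b1, b2⟩ := b
  obtain ⟨hg1, hg2⟩ := hga
  simp only at hg1 hg2 ⊢
  simp only [Prod.lt_iff] at hab hcons
  have hle1 : a1 ≤ b1 := by omega
  have hle2 : a2 ≤ b2 := by omega
  have key : ∀ x y, (x, y) ∈ E → ¬ (a1 ≤ x ∧ a2 ≤ y ∧ x ≤ b1 ∧ y ≤ b2 ∧
      (a1 < x ∨ a2 < y) ∧ (x < b1 ∨ y < b2)) := by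
    intro x y hxy h
    exact hcons _ hxy (by simp only; omega)
  rcases hle1.eq_or_lt with rfl | h1
  · have h2 : a2 < b2 := by omega
    rw [pathCount_eq_of_not_HHit (y := a2 + 1) (by omega) (by omega),
      pathCount_snd_add_one _ _ _ hg2, ind_true ⟨a1, le_rfl, ha⟩]
    rintro t ht htb ⟨s, hs, hsE⟩
    exact key _ _ (hM.mk_mem hb hsE hs htb.le) (by omega)
  · rw [pathCount_eq_of_not_HHit (y := a2) (by omega) (by omega),
      pathCount_eq_of_not_VHit hG (x := a1 + 1) (by omega) hg2 (by omega),
      pathCount_fst_add_one hG hg1 hg2, ind_true ⟨a2, le_rfl, ha⟩]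
    · rintro s hs hsb ⟨t, ht, htE⟩
      have h := hM _ htE _ hb
      refine key s (min t b2) ?_ (by omega)
      simpa [hsb.le] using h
    · rintro t ht htb ⟨s, hs, hsE⟩
      exact key _ _ (hM.mk_mem hb hsE hs htb.le) (by omega)

theorem IsSatChain.length_eq {E : Set Z2} (hM : MinClosed E) (hG : G3P E) {g : Z2}
    (hg : ∀ a ∈ E, g ≤ a) {n : ℕ} {f : ℕ → Z2} (hf : IsSatChain E n f) :
    (n : ℤ) = pathCount E g (f n).1 (f n).2 - pathCount E g (f 0).1 (f 0).2 := by
  obtain ⟨hmem, hlt, hcons⟩ := hf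
  have : ∀ m ≤ n, (m : ℤ) =
      pathCount E g (f m).1 (f m).2 - pathCount E g (f 0).1 (f 0).2 := by
    intro m
    induction m with
    | zero => simp
    | succ m ih =>
      intro hm
      rw [pathCount_of_consecutive hM hG (hg _ (hmem m (by omega))) (hmem m (by omega))
        (hmem (m + 1) hm) (hlt m (by omega)) (hcons m (by omega))]
      have := ih (by omega)
      push_cast
      linarith
  exact this n le_rfl

theorem exists_isSatChain {E : Set Z2} {a b : Z2} (ha : a ∈ E) (hb : b ∈ E) (hab : a ≤ b) :
    ∃ n f, IsSatChain E n f ∧ f 0 = a ∧ f n = b := by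
  obtain ⟨k, hk⟩ : ∃ k : ℕ, (b.1 + b.2 - (a.1 + a.2)).toNat = k := ⟨_, rfl⟩
  induction k using Nat.strong_induction_on generalizing a with
  | _ k ih =>
    rcases hab.eq_or_lt with rfl | hlt
    · exact ⟨0, fun _ => a, ⟨fun _ _ => ha, fun i hi => absurd hi (by omega),
        fun i hi => absurd hi (by omega)⟩, rfl, rfl⟩
    · obtain ⟨m, ⟨c, ⟨hcE, hac, hcb⟩, hcm⟩, hmin⟩ := Int.exists_least_of_bdd
        (P := fun m => ∃ c, (c ∈ E ∧ a < c ∧ c ≤ b) ∧ c.1 + c.2 = m)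
        ⟨a.1 + a.2, by
          rintro z ⟨c, ⟨-, hac, -⟩, rfl⟩
          rw [Prod.lt_iff] at hac
          omega⟩ ⟨_, b, ⟨hb, hlt, le_rfl⟩, rfl⟩
      have hac' := hac
      have hcb' := hcb
      rw [Prod.lt_iff] at hac'
      rw [Prod.le_def] at hcb'
      obtain ⟨n, f, ⟨h1, h2, h3⟩, h0, hn⟩ := ih _ (by omega) hcE hcb rfl
      refine ⟨n + 1, fun i => Nat.casesOn i a f, ⟨?_, ?_, ?_⟩, rfl, hn⟩
      · rintro (_ | i) hi
        · exact ha
        · exact h1 i (by omega)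
      · rintro (_ | i) hi
        · simpa [h0] using hac
        · exact h2 i (by omega)
      · rintro (_ | i) hi d hd
        · simp only [h0]
          rintro ⟨had, hdc⟩
          have := hmin _ ⟨d, ⟨hd, had, hdc.le.trans hcb⟩, rfl⟩
          rw [Prod.lt_iff] at hdc
          omega
        · exact h3 i (by omega) d hd

theorem chainDist_eq {E : Set Z2} (hM : MinClosed E) (hG : G3P E) {g : Z2}
    (hg : ∀ a ∈ E, g ≤ a) {a b : Z2} (ha : a ∈ E) (hb : b ∈ E) (hab : a ≤ b) :
    (chainDist E a b : ℤ) = pathCount E g b.1 b.2 - pathCount E g a.1 a.2 := by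
  obtain ⟨n, f, hf, h0, hn⟩ := exists_isSatChain ha hb hab
  have hset : {n : ℕ | ∃ f : ℕ → Z2, IsSatChain E n f ∧ f 0 = a ∧ f n = b} = {n} := by
    ext m
    constructor
    · rintro ⟨f', hf', h0', hn'⟩
      have h1 := hf.length_eq hM hG hg
      have h2 := hf'.length_eq hM hG hg
      rw [h0, hn] at h1
      rw [h0', hn'] at h2
      rw [Set.mem_singleton_iff]
      omega
    · rintro rfl
      exact ⟨f, hf, h0, hn⟩
  rw [chainDist, hset, csSup_singleton, hf.length_eq hM hG hg, h0, hn]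

theorem minEl_le {E : Set Z2} {g : Z2} (hg : ∀ a ∈ E, g ≤ a) {a : Z2} (ha : a ∈ E) :
    minEl E ≤ a :=
  ⟨csInf_le ⟨g.1, by rintro _ ⟨b, hb, rfl⟩; exact (hg b hb).1⟩ ⟨a, ha, rfl⟩,
    csInf_le ⟨g.2, by rintro _ ⟨b, hb, rfl⟩; exact (hg b hb).2⟩ ⟨a, ha, rfl⟩⟩

theorem minEl_mem {E : Set Z2} (hM : MinClosed E) (hne : E.Nonempty) {g : Z2}
    (hg : ∀ a ∈ E, g ≤ a) : minEl E ∈ E := by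
  obtain ⟨a, ha, h1⟩ := Int.csInf_mem (hne.image Prod.fst)
    ⟨g.1, by rintro _ ⟨b, hb, rfl⟩; exact (hg b hb).1⟩
  obtain ⟨b, hb, h2⟩ := Int.csInf_mem (hne.image Prod.snd)
    ⟨g.2, by rintro _ ⟨b, hb, rfl⟩; exact (hg b hb).2⟩
  have h3 := minEl_le hg ha
  have h4 := minEl_le hg hb
  have h5 : a ⊓ b = minEl E := by
    apply le_antisymm
    · exact ⟨inf_le_left.trans h1.le, inf_le_right.trans h2.le⟩
    · exact le_inf h3 h4
  exact h5 ▸ hM a ha b hb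

theorem pathCount_minEl {E : Set Z2} (hG : G3P E) {g : Z2} (hg : ∀ a ∈ E, g ≤ a)
    (hm : minEl E ∈ E) : pathCount E g (minEl E).1 (minEl E).2 = 0 := by
  rw [pathCount_eq_of_not_HHit le_rfl (hg _ hm).2,
    pathCount_eq_of_not_VHit hG le_rfl le_rfl (hg _ hm).1]
  · simp [pathCount]
  · rintro s - hs ⟨t, -, htE⟩
    have := (minEl_le hg htE).1
    simp only at this
    omega
  · rintro t - ht ⟨s, -, hsE⟩
    have := (minEl_le hg hsE).2
    simp only at this
    omega

/-- `f` measures, on the points above `g`, the distance between the parts of `I` and of `E`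
above a point; `f` vanishes on the cone of points above `k`. -/
structure IsLevelFn (I E : Set Z2) (g k : Z2) (f : ℤ → ℤ → ℤ) : Prop where
  subset : E ⊆ I
  minI : MinClosed I
  minE : MinClosed E
  lower : ∀ a ∈ I, g ≤ a
  fst_step : ∀ x y, g.1 ≤ x → g.2 ≤ y →
    f x y = f (x + 1) y + (ind (VHit I x y) - ind (VHit E x y))
  snd_step : ∀ x y, g.1 ≤ x → g.2 ≤ y →
    f x y = f x (y + 1) + (ind (HHit I x y) - ind (HHit E x y))
  vanish : ∀ x y, k.1 ≤ x → k.2 ≤ y → f x y = 0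

namespace IsLevelFn

variable {I E : Set Z2} {g k : Z2} {f : ℤ → ℤ → ℤ}

theorem swap (h : IsLevelFn I E g k f) :
    IsLevelFn (Prod.swap ⁻¹' I) (Prod.swap ⁻¹' E) g.swap k.swap (fun x y => f y x) where
  subset := Set.preimage_mono h.subset
  minI := fun _ ha _ hb => h.minI _ ha _ hb
  minE := fun _ ha _ hb => h.minE _ ha _ hb
  lower := fun _ ha => ⟨(h.lower _ ha).2, (h.lower _ ha).1⟩
  fst_step := fun x y hx hy => h.snd_step y x hy hx
  snd_step := fun x y hx hy => h.fst_step y x hy hx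
  vanish := fun x y hx hy => h.vanish y x hy hx

theorem antitone_fst (h : IsLevelFn I E g k f) {x x' y : ℤ} (hx : g.1 ≤ x) (hy : g.2 ≤ y)
    (hxx : x ≤ x') : f x' y ≤ f x y := by
  induction x', hxx using Int.leInduction with
  | base => rfl
  | succ s hs ih =>
    have h1 := h.fst_step s y (hx.trans hs) hy
    have h2 : ind (VHit E s y) ≤ ind (VHit I s y) :=
      ind_mono fun ⟨t, ht, htE⟩ => ⟨t, ht, h.subset htE⟩
    linarith

theorem antitone (h : IsLevelFn I E g k f) {x x' y y' : ℤ} (hx : g.1 ≤ x) (hy : g.2 ≤ y)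
    (hxx : x ≤ x') (hyy : y ≤ y') : f x' y' ≤ f x y :=
  (h.swap.antitone_fst hy (hx.trans hxx) hyy).trans (h.antitone_fst hx hy hxx)

theorem nonneg (h : IsLevelFn I E g k f) {x y : ℤ} (hx : g.1 ≤ x) (hy : g.2 ≤ y) :
    0 ≤ f x y := by
  rw [← h.vanish (max x k.1) (max y k.2) (le_max_right _ _) (le_max_right _ _)]
  exact h.antitone hx hy (le_max_left _ _) (le_max_left _ _)

/-- If only `I` meets the vertical half-line at `(x, y)`, then its lowest point there lies in
`I ∖ E` and has the same level as `(x, y)`. -/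
theorem exists_vertical (h : IsLevelFn I E g k f) {x y : ℤ} (hx : g.1 ≤ x) (hy : g.2 ≤ y)
    (hI : VHit I x y) (hE : ¬ VHit E x y) :
    ∃ t, y ≤ t ∧ (x, t) ∈ I \ E ∧ f x t = f x y := by
  obtain ⟨t, ⟨hyt, htI⟩, hmin⟩ := Int.exists_least_of_bdd
    (P := fun t => y ≤ t ∧ (x, t) ∈ I) ⟨y, fun z hz => hz.1⟩ hI
  refine ⟨t, hyt, ⟨htI, fun htE => hE ⟨t, hyt, htE⟩⟩, ?_⟩
  have key : ∀ u, y ≤ u → u ≤ t → f x u = f x y := by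
    intro u hu
    induction u, hu using Int.leInduction with
    | base => exact fun _ => rfl
    | succ u hu ih =>
      intro hut
      have hnI : ¬ HHit I x u := by
        rintro ⟨s, hs, hsI⟩
        have := hmin u ⟨hu, h.minI.mk_mem htI hsI hs (by omega)⟩
        omega
      have hnE : ¬ HHit E x u := fun ⟨s, hs, hsE⟩ => hnI ⟨s, hs, h.subset hsE⟩
      have h1 := h.snd_step x u hx (hy.trans hu)
      rw [ind_false hnI, ind_false hnE, ih (by omega)] at h1
      linarith
  exact key t hyt le_rfl

theorem exists_horizontal (h : IsLevelFn I E g k f) {x y : ℤ} (hx : g.1 ≤ x) (hy : g.2 ≤ y)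
    (hI : HHit I x y) (hE : ¬ HHit E x y) :
    ∃ s, x ≤ s ∧ (s, y) ∈ I \ E ∧ f s y = f x y :=
  h.swap.exists_vertical hy hx hI hE

/-- Walking to the right, either a point of `I ∖ E` of the same level is found or the level
never changes. -/
theorem exists_or_constant (h : IsLevelFn I E g k f) {x y : ℤ} (hx : g.1 ≤ x) (hy : g.2 ≤ y)
    {x' : ℤ} (hxx : x ≤ x') :
    (∃ b ∈ I \ E, (x, y) ≤ b ∧ f b.1 b.2 = f x y) ∨ f x' y = f x y := by
  induction x', hxx using Int.leInduction with
  | base => exact Or.inr rfl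
  | succ s hs ih =>
    rcases ih with ih | ih
    · exact Or.inl ih
    · have h1 := h.fst_step s y (hx.trans hs) hy
      by_cases hE : VHit E s y
      · have hI : VHit I s y := hE.imp fun t ht => ⟨ht.1, h.subset ht.2⟩
        rw [ind_true hE, ind_true hI] at h1
        exact Or.inr (by linarith)
      · by_cases hI : VHit I s y
        · obtain ⟨t, hyt, htA, hft⟩ := h.exists_vertical (hx.trans hs) hy hI hE
          exact Or.inl ⟨(s, t), htA, ⟨hs, hyt⟩, hft.trans ih⟩
        · rw [ind_false hE, ind_false hI] at h1
          exact Or.inr (by linarith)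

theorem exists_same_level (h : IsLevelFn I E g k f) {x y : ℤ} (hx : g.1 ≤ x) (hy : g.2 ≤ y)
    (hpos : 0 < f x y) : ∃ b ∈ I \ E, (x, y) ≤ b ∧ f b.1 b.2 = f x y := by
  rcases h.exists_or_constant hx hy (le_max_left x k.1) with h1 | h1
  · exact h1
  · have hx' : g.1 ≤ max x k.1 := hx.trans (le_max_left _ _)
    rcases h.swap.exists_or_constant hy hx' (le_max_left y k.2) with ⟨b, hb, hle, hfb⟩ | h2
    · exact ⟨b.swap, hb, ⟨(le_max_left _ _).trans hle.2, hle.1⟩, hfb.trans h1⟩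
    · rw [h1, h.vanish _ _ (le_max_right _ _) (le_max_right _ _)] at h2
      omega

theorem step_fst_of_not_VHit (h : IsLevelFn I E g k f) {a : Z2} (ha : a ∈ I)
    (hE : ¬ VHit E a.1 a.2) : f a.1 a.2 = f (a.1 + 1) a.2 + 1 := by
  rw [h.fst_step _ _ (h.lower a ha).1 (h.lower a ha).2, ind_false hE,
    ind_true (P := VHit I a.1 a.2) ⟨a.2, le_rfl, ha⟩]
  ring

theorem step_snd_of_not_HHit (h : IsLevelFn I E g k f) {a : Z2} (ha : a ∈ I)
    (hE : ¬ HHit E a.1 a.2) : f a.1 a.2 = f a.1 (a.2 + 1) + 1 :=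
  h.swap.step_fst_of_not_VHit (a := a.swap) ha hE

theorem not_VHit_or_not_HHit (h : IsLevelFn I E g k f) {a : Z2} (ha : a ∉ E) :
    ¬ VHit E a.1 a.2 ∨ ¬ HHit E a.1 a.2 := by
  by_contra! hcon
  obtain ⟨⟨t, ht, htE⟩, s, hs, hsE⟩ := hcon
  exact ha (h.minE.mk_mem htE hsE hs ht)

theorem pos (h : IsLevelFn I E g k f) {a : Z2} (ha : a ∈ I \ E) : 0 < f a.1 a.2 := by
  obtain ⟨h1, h2⟩ := h.lower a ha.1
  rcases h.not_VHit_or_not_HHit ha.2 with hE | hE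
  · rw [h.step_fst_of_not_VHit ha.1 hE]
    have := h.nonneg (x := a.1 + 1) (y := a.2) (by omega) h2
    omega
  · rw [h.step_snd_of_not_HHit ha.1 hE]
    have := h.nonneg (x := a.1) (y := a.2 + 1) h1 (by omega)
    omega

theorem lt_of_llt (h : IsLevelFn I E g k f) {a b : Z2} (ha : a ∈ I \ E) (hab : llt a b) :
    f b.1 b.2 < f a.1 a.2 := by
  obtain ⟨h1, h2⟩ := h.lower a ha.1
  obtain ⟨hab1, hab2⟩ := hab
  rcases h.not_VHit_or_not_HHit ha.2 with hE | hE
  · rw [h.step_fst_of_not_VHit ha.1 hE]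
    have := h.antitone (x := a.1 + 1) (y := a.2) (x' := b.1) (y' := b.2)
      (by omega) h2 hab1 hab2.le
    omega
  · rw [h.step_snd_of_not_HHit ha.1 hE]
    have := h.antitone (x := a.1) (y := a.2 + 1) (x' := b.1) (y' := b.2)
      h1 (by omega) hab1.le hab2
    omega

/-- If `a ∈ I ∖ E` has level above `i ≥ 1`, then some point of `I ∖ E` of level at least `i` is
strictly larger in both coordinates, or `a` is the minimum of two points of level `i`. -/
theorem exists_llt_or_min (h : IsLevelFn I E g k f) {a : Z2} (ha : a ∈ I \ E) {i : ℤ}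
    (hi : 1 ≤ i) (hai : i < f a.1 a.2) :
    (∃ b ∈ I \ E, llt a b ∧ i ≤ f b.1 b.2) ∨
    ∃ s t, a.1 < s ∧ a.2 < t ∧ (s, a.2) ∈ I \ E ∧ (a.1, t) ∈ I \ E ∧ f s a.2 = i ∧
      f a.1 t = i := by
  obtain ⟨h1, h2⟩ := h.lower a ha.1
  have diag : i ≤ f (a.1 + 1) (a.2 + 1) → ∃ b ∈ I \ E, llt a b ∧ i ≤ f b.1 b.2 := by
    intro hd
    obtain ⟨b, hb, hle, hfb⟩ := h.exists_same_level (x := a.1 + 1) (y := a.2 + 1)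
      (by omega) (by omega) (by omega)
    exact ⟨b, hb, ⟨hle.1, hle.2⟩, by omega⟩
  have hVI : VHit I a.1 a.2 := ⟨a.2, le_rfl, ha.1⟩
  have hHI : HHit I a.1 a.2 := ⟨a.1, le_rfl, ha.1⟩
  have f1 := h.fst_step a.1 a.2 h1 h2
  have f2 := h.snd_step a.1 a.2 h1 h2
  have f12 := h.snd_step (a.1 + 1) a.2 (by omega) h2
  have f21 := h.fst_step a.1 (a.2 + 1) h1 (by omega)
  rw [ind_true hVI] at f1
  rw [ind_true hHI] at f2
  by_cases hV : VHit E a.1 a.2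
  · left
    apply diag
    have hV' : VHit E a.1 (a.2 + 1) := by
      obtain ⟨t, ht, htE⟩ := hV
      refine ⟨t, lt_of_le_of_ne ht ?_, htE⟩
      rintro rfl
      exact ha.2 htE
    have hVI' : VHit I a.1 (a.2 + 1) := hV'.imp fun t ht => ⟨ht.1, h.subset ht.2⟩
    have := ind_nonneg (HHit E a.1 a.2)
    rw [ind_true hV', ind_true hVI'] at f21
    linarith
  by_cases hH : HHit E a.1 a.2
  · left
    apply diag
    have hH' : HHit E (a.1 + 1) a.2 := by
      obtain ⟨t, ht, htE⟩ := hH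
      refine ⟨t, lt_of_le_of_ne ht ?_, htE⟩
      rintro rfl
      exact ha.2 htE
    have hHI' : HHit I (a.1 + 1) a.2 := hH'.imp fun t ht => ⟨ht.1, h.subset ht.2⟩
    have := ind_nonneg (VHit E a.1 a.2)
    rw [ind_true hH', ind_true hHI'] at f12
    linarith
  have hV' : ¬ VHit E a.1 (a.2 + 1) := fun ⟨t, ht, htE⟩ => hV ⟨t, by omega, htE⟩
  have hH' : ¬ HHit E (a.1 + 1) a.2 := fun ⟨t, ht, htE⟩ => hH ⟨t, by omega, htE⟩
  rw [ind_false hV] at f1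
  rw [ind_false hH] at f2
  rw [ind_false hV'] at f21
  rw [ind_false hH'] at f12
  by_cases hd : i ≤ f (a.1 + 1) (a.2 + 1)
  · exact Or.inl (diag hd)
  right
  by_cases hVI' : VHit I a.1 (a.2 + 1)
  · by_cases hHI' : HHit I (a.1 + 1) a.2
    · obtain ⟨t, ht, htA, hft⟩ := h.exists_vertical h1 (by omega) hVI' hV'
      obtain ⟨s, hs, hsA, hfs⟩ := h.exists_horizontal (by omega) h2 hHI' hH'
      rw [ind_true hVI'] at f21
      rw [ind_true hHI'] at f12
      exact ⟨s, t, hs, ht, hsA, htA, by omega, by omega⟩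
    · rw [ind_false hHI'] at f12
      omega
  · rw [ind_false hVI'] at f21
    omega

theorem Dof_eq (h : IsLevelFn I E g k f) {i : ℤ} (hi : 1 ≤ i) :
    Dof {a ∈ I \ E | i ≤ f a.1 a.2} = {a ∈ I \ E | f a.1 a.2 = i} := by
  have hB : ∀ a ∈ I \ E, f a.1 a.2 = i → a ∈ Bof {a ∈ I \ E | i ≤ f a.1 a.2} := by
    intro a ha hai
    refine ⟨⟨ha, hai.ge⟩, fun b hb hab => ?_⟩
    have h1 := h.lt_of_llt ha hab
    have h2 := hb.2
    omega
  ext a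
  constructor
  · rintro ⟨haB, haC⟩
    obtain ⟨⟨haA, hai⟩, hmax⟩ := haB
    refine ⟨haA, hai.antisymm' ?_⟩
    by_contra! hlt
    rcases h.exists_llt_or_min haA hi hlt with ⟨b, hb, hab, hib⟩ |
      ⟨s, t, hs, ht, hsA, htA, hfs, hft⟩
    · exact hmax b ⟨hb, hib⟩ hab
    · refine haC ⟨⟨⟨haA, hai⟩, hmax⟩, (a.1, t), hB _ htA hft, (s, a.2), hB _ hsA hfs, ?_, ?_, ?_⟩
      · intro heq
        have := congrArg Prod.snd heq
        simp only at this
        omega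
      · intro heq
        have := congrArg Prod.fst heq
        simp only at this
        omega
      · ext
        · simp [hs.le]
        · simp [ht.le]
  · rintro ⟨haA, hai⟩
    refine ⟨hB a haA hai, ?_⟩
    rintro ⟨-, b, hb, c, hc, hba, hca, hmin⟩
    have hfb := hb.1.2
    have hfc := hc.1.2
    obtain ⟨g1, g2⟩ := h.lower a haA.1
    have hab : a ≤ b := hmin ▸ inf_le_left
    have hac : a ≤ c := hmin ▸ inf_le_right
    have e1 : a.1 = min b.1 c.1 := congrArg Prod.fst hmin
    have e2 : a.2 = min b.2 c.2 := congrArg Prod.snd hmin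
    have nb : ¬ (b.1 = a.1 ∧ b.2 = a.2) := fun hh => hba (Prod.ext hh.1 hh.2)
    have nc : ¬ (c.1 = a.1 ∧ c.2 = a.2) := fun hh => hca (Prod.ext hh.1 hh.2)
    have hab1 := hab.1
    have hab2 := hab.2
    have hac1 := hac.1
    have hac2 := hac.2
    rcases h.not_VHit_or_not_HHit haA.2 with hE | hE
    · have h1 := h.step_fst_of_not_VHit haA.1 hE
      have key : ∀ d : Z2, a.1 < d.1 → a.2 ≤ d.2 → f d.1 d.2 < i := by
        intro d hd1 hd2
        have := h.antitone (x := a.1 + 1) (y := a.2) (x' := d.1) (y' := d.2)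
          (by omega) g2 hd1 hd2
        omega
      have kb := key b
      have kc := key c
      omega
    · have h1 := h.step_snd_of_not_HHit haA.1 hE
      have key : ∀ d : Z2, a.1 ≤ d.1 → a.2 < d.2 → f d.1 d.2 < i := by
        intro d hd1 hd2
        have := h.antitone (x := a.1) (y := a.2 + 1) (x' := d.1) (y' := d.2)
          g1 (by omega) hd1 hd2
        omega
      have kb := key b
      have kc := key c
      omega

theorem NLrem_eq (h : IsLevelFn I E g k f) (n : ℕ) :
    NLrem (I \ E) n = {a ∈ I \ E | f a.1 a.2 ≤ n} := by
  induction n with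
  | zero =>
    symm
    rw [NLrem, Set.eq_empty_iff_forall_notMem]
    rintro a ⟨ha, hle⟩
    have := h.pos ha
    push_cast at hle
    omega
  | succ n ih =>
    have hrem : (I \ E) \ NLrem (I \ E) n = {a ∈ I \ E | (n : ℤ) + 1 ≤ f a.1 a.2} := by
      rw [ih]
      ext a
      simp only [Set.mem_sdiff, Set.mem_ofPred_eq, not_and, not_le]
      constructor
      · rintro ⟨h1, h2⟩
        exact ⟨h1, h2 h1⟩
      · rintro ⟨h1, h2⟩
        exact ⟨h1, fun _ => h2⟩
    rw [NLrem, hrem, h.Dof_eq (by omega), ih]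
    ext a
    simp only [Set.mem_union, Set.mem_ofPred_eq, ← and_or_left]
    push_cast
    exact and_congr_right fun _ => by omega

theorem NL_eq (h : IsLevelFn I E g k f) : (NL (I \ E) : ℤ) = f g.1 g.2 := by
  have hnn := h.nonneg (le_refl g.1) (le_refl g.2)
  have hset : {N : ℕ | I \ E ⊆ NLrem (I \ E) N} = Set.Ici (f g.1 g.2).toNat := by
    ext N
    rw [Set.mem_ofPred_eq, h.NLrem_eq, Set.mem_Ici]
    constructor
    · intro hsub
      by_contra! hlt
      obtain ⟨b, hb, -, hfb⟩ := h.exists_same_level (le_refl g.1) (le_refl g.2) (by omega)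
      have := (hsub hb).2
      omega
    · intro hN a ha
      refine ⟨ha, ?_⟩
      have := h.antitone le_rfl le_rfl (h.lower a ha.1).1 (h.lower a ha.1).2
      omega
  rw [NL, hset, csInf_Ici]
  omega

end IsLevelFn

theorem IsRelGoodIdeal.exists_lower {S E : Set Z2} (hS : IsGood S) (hE : IsRelGoodIdeal S E) :
    ∃ g : Z2, ∀ a ∈ E, g ≤ a := by
  obtain ⟨-, -, ⟨s, -, hs⟩, -, -⟩ := hE
  refine ⟨-s, fun a ha => ?_⟩
  obtain ⟨h1, h2⟩ := hS.1 (hs a ha)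
  simp only [Prod.fst_add, Prod.snd_add] at h1 h2
  constructor
  · simp only [Prod.fst_neg]
    omega
  · simp only [Prod.snd_neg]
    omega

theorem IsRelGoodIdeal.exists_cone {S E : Set Z2} (hS : IsGood S) (hE : IsRelGoodIdeal S E) :
    ∃ k : Z2, ∀ a, k ≤ a → a ∈ E := by
  obtain ⟨⟨e, he⟩, hadd, -, -, -⟩ := hE
  obtain ⟨-, -, -, -, ⟨δ, hδ⟩, -⟩ := hS
  refine ⟨e + δ, fun a ha => ?_⟩
  have := hadd e he (a - e) (hδ _ (le_sub_iff_add_le'.mpr ha))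
  simpa using this

theorem isLevelFn_pathCount {I E : Set Z2} (hEI : E ⊆ I) (hMI : MinClosed I) (hGI : G3P I)
    (hME : MinClosed E) (hGE : G3P E) {g k : Z2} (hg : ∀ a ∈ I, g ≤ a) (hgk : g ≤ k)
    (hk : ∀ a, k ≤ a → a ∈ E) :
    IsLevelFn I E g k fun x y => (pathCount I g k.1 k.2 - pathCount E g k.1 k.2) -
      (pathCount I g x y - pathCount E g x y) where
  subset := hEI
  minI := hMI
  minE := hME
  lower := hg
  fst_step x y hx hy := by
    rw [pathCount_fst_add_one hGI hx hy, pathCount_fst_add_one hGE hx hy]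
    ring
  snd_step x y hx hy := by
    rw [pathCount_snd_add_one _ _ _ hy, pathCount_snd_add_one _ _ _ hy]
    ring
  vanish x y hx hy := by
    have hkE : ∀ s t, k.1 ≤ s → k.2 ≤ t → (s, t) ∈ E := fun s t hs ht => hk _ ⟨hs, ht⟩
    have h1 : pathCount I g x k.2 - pathCount E g x k.2 =
        pathCount I g k.1 k.2 - pathCount E g k.1 k.2 := by
      induction x, hx using Int.leInduction with
      | base => rfl
      | succ s hs ih =>
        rw [pathCount_fst_add_one hGI (hgk.1.trans hs) hgk.2,
          pathCount_fst_add_one hGE (hgk.1.trans hs) hgk.2,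
          ind_true ⟨k.2, le_rfl, hEI (hkE _ _ hs le_rfl)⟩,
          ind_true ⟨k.2, le_rfl, hkE _ _ hs le_rfl⟩]
        linarith
    have h2 : pathCount I g x y - pathCount E g x y =
        pathCount I g x k.2 - pathCount E g x k.2 := by
      induction y, hy using Int.leInduction with
      | base => rfl
      | succ t ht ih =>
        rw [pathCount_snd_add_one _ _ _ (hgk.2.trans ht),
          pathCount_snd_add_one _ _ _ (hgk.2.trans ht),
          ind_true ⟨x, le_rfl, hEI (hkE _ _ hx ht)⟩, ind_true ⟨x, le_rfl, hkE _ _ hx ht⟩]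
        linarith
    linarith

/-- If `I` is a relative good ideal of a local good
semigroup `S ⊆ ℕ²` and `A ⊆ I` is such that `c + ℕ² ⊆ ℕ²∖A` for some
`c ∈ ℕ²` and `E = I∖A` is a relative good ideal of `S`, then
`NL(A) = d(I∖E)`. -/
theorem NL_eq_dist (S I A : Set Z2) (hS : IsGood S) (hl : IsLocal S)
    (hI : IsRelGoodIdeal S I) (hAI : A ⊆ I)
    (hc : ∃ c ∈ orth, ∀ x : Z2, c ≤ x → x ∉ A)
    (hE : IsRelGoodIdeal S (I \ A)) :
    (NL A : ℤ) = dist2 I (I \ A) := by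
  obtain ⟨g, hg⟩ := hI.exists_lower hS
  obtain ⟨k, hk⟩ := hE.exists_cone hS
  have hEI : I \ A ⊆ I := Set.sdiff_subset
  have hgE : ∀ a ∈ I \ A, g ≤ a := fun a ha => hg a (hEI ha)
  have hkE : k ∈ I \ A := hk k le_rfl
  obtain ⟨hneI, -, -, hMI, hGI⟩ := hI
  obtain ⟨hneE, -, -, hME, hGE⟩ := hE
  have hlev := isLevelFn_pathCount hEI hMI hGI hME hGE hg (hgE k hkE) hk
  have hmI := minEl_mem hMI hneI hg
  have hmE := minEl_mem hME hneE hgE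
  have hNL := hlev.NL_eq
  rw [Set.sdiff_sdiff_cancel_left hAI] at hNL
  have hdist : ∀ α ∈ I \ A, k ≤ α →
      (chainDist I (minEl I) α : ℤ) - (chainDist (I \ A) (minEl (I \ A)) α : ℤ) = NL A := by
    intro α hα hkα
    rw [chainDist_eq hMI hGI hg hmI (hEI hα) (minEl_le hg (hEI hα)),
      chainDist_eq hME hGE hgE hmE hα (minEl_le hgE hα), pathCount_minEl hGI hg hmI,
      pathCount_minEl hGE hgE hmE, hNL]
    have := hlev.vanish α.1 α.2 hkα.1 hkα.2
    simp only [pathCount, Finset.Ico_self, Finset.sum_empty] at this ⊢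
    linarith
  have hset : {z : ℤ | ∃ β : Z2, ∀ α ∈ I \ A, β ≤ α →
      (chainDist I (minEl I) α : ℤ) - (chainDist (I \ A) (minEl (I \ A)) α : ℤ) = z} =
      {(NL A : ℤ)} := by
    ext z
    constructor
    · rintro ⟨β, hβ⟩
      rw [Set.mem_singleton_iff, ← hβ (β ⊔ k) (hk _ le_sup_right) le_sup_left]
      exact hdist _ (hk _ le_sup_right) le_sup_right
    · rintro rfl
      exact ⟨k, hdist⟩
  rw [dist2, hset, csSup_singleton]
end

section
/- For every local good semigroup S ⊆ ℕ², the genus, type, and length satisfy g(S) ≤ t(S)·l(S). -/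
namespace GoodSemigroup

/-! ### Reflection in the diagonal -/

/-- The reflection of a subset of the plane in the diagonal. -/
def sw (E : Set Z2) : Set Z2 := {a | a.swap ∈ E}

lemma sw_sw (E : Set Z2) : sw (sw E) = E := rfl

lemma minClosed_sw {E : Set Z2} (h : MinClosed E) : MinClosed (sw E) :=
  fun a ha b hb => h a.swap ha b.swap hb

lemma g3P_sw {E : Set Z2} (h : G3P E) : G3P (sw E) := by
  intro a ha b hb hab
  have hne : a.swap ≠ b.swap := fun h => hab (Prod.swap_injective h)
  obtain ⟨h1, h2⟩ := h a.swap ha b.swap hb hne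
  refine ⟨fun h => ?_, fun h => ?_⟩
  · obtain ⟨e, he, h⟩ := h2 h
    exact ⟨e.swap, he, h⟩
  · obtain ⟨e, he, h⟩ := h1 h
    exact ⟨e.swap, he, h⟩

/-! ### Gaps along lattice paths -/

/-- `E` meets the vertical ray going up from `a`. -/
def colHit (E : Set Z2) (a : Z2) : Prop := ∃ y, a.2 ≤ y ∧ (a.1, y) ∈ E

/-- `E` meets the horizontal ray going right from `a`. -/
def rowHit (E : Set Z2) (a : Z2) : Prop := ∃ x, a.1 ≤ x ∧ (x, a.2) ∈ E

open Classical in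
/-- The number of steps of the lattice path `P` starting at `a` whose transversal ray misses `E`;
`true` is a unit step to the right and `false` a unit step up. -/
noncomputable def gaps (E : Set Z2) : List Bool → Z2 → ℕ
  | [], _ => 0
  | true :: P, a => (if colHit E a then 0 else 1) + gaps E P (a.1 + 1, a.2)
  | false :: P, a => (if rowHit E a then 0 else 1) + gaps E P (a.1, a.2 + 1)

lemma gaps_sw (E : Set Z2) (P : List Bool) (a : Z2) :
    gaps (sw E) (P.map not) a.swap = gaps E P a := by
  induction P generalizing a with
  | nil => rfl
  | cons s P ih =>
    have h1 : rowHit (sw E) a.swap ↔ colHit E a := Iff.rfl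
    have h2 : colHit (sw E) a.swap ↔ rowHit E a := Iff.rfl
    cases s
    · simp only [List.map_cons, Bool.not_false, gaps, h2, ← ih]
      rfl
    · simp only [List.map_cons, Bool.not_true, gaps, h1, ← ih]
      rfl

lemma le_of_up_le {a b : Z2} (h : (a.1, a.2 + 1) ≤ b) : a ≤ b :=
  ⟨h.1, (Int.le_add_one le_rfl).trans h.2⟩

lemma le_of_right_le {a b : Z2} (h : (a.1 + 1, a.2) ≤ b) : a ≤ b :=
  ⟨(Int.le_add_one le_rfl).trans h.1, h.2⟩

lemma gaps_eq_zero {E : Set Z2} (P : List Bool) {a : Z2} (h : ∀ b, a ≤ b → b ∈ E) :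
    gaps E P a = 0 := by
  induction P generalizing a with
  | nil => rfl
  | cons s P ih =>
    have h1 : colHit E a := ⟨a.2, le_rfl, h _ le_rfl⟩
    have h2 : rowHit E a := ⟨a.1, le_rfl, h _ le_rfl⟩
    cases s
    · rw [gaps, if_pos h2, ih fun b hb => h b (le_of_up_le hb)]
    · rw [gaps, if_pos h1, ih fun b hb => h b (le_of_right_le hb)]

/-- Moving the starting point of a path up by `n` loses at most `n` gaps. -/
lemma exists_gaps_le_add (E : Set Z2) (P : List Bool) (a : Z2) (n : ℕ) :
    ∃ Q, gaps E P a ≤ n + gaps E Q (a.1, a.2 + n) := by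
  induction P generalizing a n with
  | nil => exact ⟨[], by simp [gaps]⟩
  | cons s P ih =>
    cases s
    · cases n with
      | zero => exact ⟨false :: P, by simp⟩
      | succ n =>
        obtain ⟨Q, hQ⟩ := ih (a.1, a.2 + 1) n
        refine ⟨Q, ?_⟩
        have e : a.2 + ((n + 1 : ℕ) : ℤ) = a.2 + 1 + n := by push_cast; ring
        rw [gaps, e]
        simp only at hQ
        split_ifs <;> omega
    · obtain ⟨Q, hQ⟩ := ih (a.1 + 1, a.2) n
      refine ⟨true :: Q, ?_⟩
      have h : colHit E (a.1, a.2 + n) → colHit E a := by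
        rintro ⟨y, hy, hE⟩
        exact ⟨y, by simp only at hy; omega, hE⟩
      simp only [gaps]
      simp only at hQ
      split_ifs <;> first | omega | (exfalso; tauto)

lemma add_gaps_le_of_not_rowHit {E : Set Z2} (Q : List Bool) (n : ℕ) (a : Z2)
    (h : ∀ i < n, ¬ rowHit E (a.1, a.2 + i)) :
    n + gaps E Q (a.1, a.2 + n + 1) ≤ gaps E (List.replicate n false ++ false :: Q) a := by
  induction n generalizing a with
  | zero => simp [gaps]
  | succ n ih =>
    have h0 : ¬ rowHit E a := by simpa using h 0 (by omega)
    have := ih (a.1, a.2 + 1) fun i hi => by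
      have := h (i + 1) (by omega)
      push_cast at this
      rwa [add_comm (i : ℤ) 1, ← add_assoc] at this
    have e : a.2 + ((n + 1 : ℕ) : ℤ) + 1 = a.2 + 1 + n + 1 := by push_cast; ring
    simp only [List.replicate_succ, List.cons_append, gaps, h0, if_false]
    rw [e]
    simp only at this
    omega

/-! ### Labelings -/

/-- A labeling of `A` that strictly decreases along `≪` and such that no label of a componentwise
minimum is at most both labels of the two elements defining it. -/
structure IsLabeling (A : Set Z2) (lab : Z2 → ℕ) : Prop where
  llt_lt : ∀ a ∈ A, ∀ b ∈ A, llt a b → lab b < lab a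
  min_lt : ∀ a ∈ A, ∀ b ∈ A, ∀ c ∈ A, a.1 = b.1 → a.2 < b.2 → a.2 = c.2 → a.1 < c.1 →
    lab b < lab a ∨ lab c < lab a

lemma IsLabeling.sw {A : Set Z2} {lab : Z2 → ℕ} (h : IsLabeling A lab) :
    IsLabeling (sw A) (fun a => lab a.swap) where
  llt_lt _ ha _ hb hab := h.llt_lt _ ha _ hb ⟨hab.2, hab.1⟩
  min_lt _ ha _ hb _ hc h1 h2 h3 h4 := (h.min_lt _ ha _ hc _ hb h3 h4 h1 h2).symm

/-- Up to `k` gaps, the path `P` can be replaced by a path with as many gaps for `E'` as `P`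
has for `E`. -/
def Dominated (E E' : Set Z2) (k : ℕ) (P : List Bool) (a : Z2) : Prop :=
  ∃ Q, gaps E P a ≤ k + gaps E' Q a

lemma Dominated.sw {E E' : Set Z2} {k : ℕ} {P : List Bool} {a : Z2}
    (h : Dominated E E' k P a) : Dominated (sw E) (sw E') k (P.map not) a.swap := by
  obtain ⟨Q, hQ⟩ := h
  exact ⟨Q.map not, by rwa [gaps_sw, gaps_sw]⟩

lemma dominated_cons_true {E E' : Set Z2} {lab : Z2 → ℕ} {k : ℕ} {P : List Bool} {a : Z2}
    (hE' : MinClosed E') (hsub : E ⊆ E') (hlab : IsLabeling (E' \ E) lab)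
    (hk : ∀ b ∈ E' \ E, a ≤ b → lab b < k)
    (ihk : ∀ j < k, ∀ P a, (∀ b ∈ E' \ E, a ≤ b → lab b < j) → Dominated E E' j P a)
    (ihP : Dominated E E' k P (a.1 + 1, a.2)) : Dominated E E' k (true :: P) a := by
  by_cases hc : colHit E' a → colHit E a
  · obtain ⟨Q, hQ⟩ := ihP
    refine ⟨true :: Q, ?_⟩
    have hc' : colHit E a ↔ colHit E' a := ⟨fun ⟨y, hy, h⟩ => ⟨y, hy, hsub h⟩, hc⟩
    simp only [gaps]
    split_ifs <;> first | omega | (exfalso; tauto)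
  obtain ⟨⟨y, hy, hyE'⟩, hcE⟩ : colHit E' a ∧ ¬ colHit E a := by tauto
  have hcol : ∀ z, a.2 ≤ z → (a.1, z) ∉ E := fun z hz h => hcE ⟨z, hz, h⟩
  have hyk := hk _ ⟨hyE', hcol y hy⟩ ⟨le_rfl, hy⟩
  obtain ⟨j, rfl⟩ : ∃ j, k = j + 1 := ⟨k - 1, by omega⟩
  have hcE' : colHit E' a := ⟨y, hy, hyE'⟩
  by_cases hj : ∀ b ∈ E' \ E, ((a.1 + 1, a.2) : Z2) ≤ b → lab b < j
  · obtain ⟨Q, hQ⟩ := ihk j (by omega) P _ hj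
    refine ⟨true :: Q, ?_⟩
    simp only [gaps, hcE, hcE', if_true, if_false]
    omega
  push Not at hj
  obtain ⟨⟨x', y'⟩, hz, ⟨hx', hy'⟩, hzj⟩ := hj
  simp only at hx' hy'
  have hyy' : y' ≤ y := by
    by_contra! hlt
    have := hlab.llt_lt _ ⟨hyE', hcol y hy⟩ _ hz ⟨by simp only; omega, hlt⟩
    omega
  have hcorner : (a.1, y') ∈ E' \ E := by
    refine ⟨?_, hcol y' hy'⟩
    have := hE' _ hyE' _ hz.1
    rwa [Prod.mk_inf_mk, inf_of_le_left (by omega), inf_of_le_right hyy'] at this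
  have hcornerk := hk _ hcorner ⟨le_rfl, hy'⟩
  have hrow : ∀ u w, a.1 ≤ u → a.2 ≤ w → w < y' → (u, w) ∉ E' := by
    intro u w hu hw hwy h
    have hm := hE' _ hcorner.1 _ h
    rw [Prod.mk_inf_mk, inf_of_le_left hu, inf_of_le_right hwy.le] at hm
    have := hlab.llt_lt _ ⟨hm, hcol w hw⟩ _ hz ⟨by simp only; omega, hwy⟩
    have := hk _ ⟨hm, hcol w hw⟩ ⟨le_rfl, hw⟩
    omega
  obtain ⟨n, hn⟩ : ∃ n : ℕ, y' = a.2 + n := ⟨(y' - a.2).toNat, by omega⟩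
  subst hn
  have hb : ∀ b ∈ E' \ E, ((a.1, a.2 + n + 1) : Z2) ≤ b → lab b < j := by
    rintro ⟨u, w⟩ h ⟨hu, hw⟩
    simp only at hu hw
    rcases hu.eq_or_lt with rfl | hu
    · rcases hlab.min_lt _ hcorner _ h _ hz rfl (by simp only; omega) rfl
        (by simp only; omega) with h | h <;> omega
    · have := hlab.llt_lt _ hcorner _ h ⟨hu, by simp only; omega⟩
      omega
  obtain ⟨R, hR⟩ := exists_gaps_le_add E (true :: P) a (n + 1)
  obtain ⟨Q, hQ⟩ := ihk j (by omega) R _ hb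
  refine ⟨List.replicate n false ++ false :: Q, ?_⟩
  have := add_gaps_le_of_not_rowHit Q n a (E := E') (by
    rintro i hi ⟨u, hu, h⟩
    exact hrow u (a.2 + i) hu (by omega) (by omega) h)
  push_cast at hR
  rw [← add_assoc] at hR
  omega

theorem dominated_of_isLabeling {E E' : Set Z2} {lab : Z2 → ℕ} (hE' : MinClosed E')
    (hsub : E ⊆ E') (hlab : IsLabeling (E' \ E) lab) (k : ℕ) (P : List Bool) (a : Z2)
    (hk : ∀ b ∈ E' \ E, a ≤ b → lab b < k) : Dominated E E' k P a := by
  induction k using Nat.strong_induction_on generalizing P a with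
  | _ k ihk =>
    induction P generalizing a with
    | nil => exact ⟨[], by simp [gaps]⟩
    | cons s P ihP =>
      cases s
      · have ih := ihP (a.1, a.2 + 1) fun b hb hab => hk b hb (le_of_up_le hab)
        have := dominated_cons_true (E := sw E) (E' := sw E') (k := k) (a := a.swap)
          (P := P.map not) (minClosed_sw hE') (fun b hb => hsub hb) hlab.sw
          (fun b hb hab => hk _ hb ⟨hab.2, hab.1⟩) (fun j hj Q b hb => ?_) ih.sw
        · simpa [List.map_map, Function.comp_def, sw_sw] using this.sw
        · have := (ihk j hj (Q.map not) b.swap fun c hc hbc => hb c.swap hc ⟨hbc.2, hbc.1⟩).sw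
          simpa [List.map_map, Function.comp_def] using this
      · exact dominated_cons_true hE' hsub hlab hk ihk
          (ihP _ fun b hb hab => hk b hb (le_of_right_le hab))

/-! ### Levels as labels -/

/-- The index, counted from `0`, of the level of `A` that contains `a`. -/
noncomputable def lev (A : Set Z2) (a : Z2) : ℕ := sInf {N | a ∈ NLrem A (N + 1)}

lemma lev_lt {A : Set Z2} {a : Z2} {k : ℕ} (h : a ∈ NLrem A k) : lev A a < k := by
  cases k with
  | zero => exact h.elim
  | succ k => exact Nat.lt_succ_of_le (Nat.sInf_le h)

lemma mem_Dof_lev {A : Set Z2} {a : Z2} {k : ℕ} (h : a ∈ NLrem A k) :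
    a ∈ Dof (A \ NLrem A (lev A a)) := by
  have hne : {N | a ∈ NLrem A (N + 1)}.Nonempty := by
    cases k with
    | zero => exact h.elim
    | succ k => exact ⟨k, h⟩
  rcases Nat.sInf_mem hne with h | h
  · exact absurd (lev_lt h) (lt_irrefl _)
  · exact h

lemma isLabeling_lev {A : Set Z2} {N : ℕ} (hN : A ⊆ NLrem A N) : IsLabeling A (lev A) where
  llt_lt a ha b hb hab := by
    by_contra! hle
    exact (mem_Dof_lev (hN ha)).1.2 b ⟨hb, fun h => absurd (lev_lt h) (not_lt.2 hle)⟩ hab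
  min_lt a ha b hb c hc h1 h2 h3 h4 := by
    by_contra! hle
    obtain ⟨hB, hC⟩ := mem_Dof_lev (hN ha)
    have hmem : ∀ d ∈ A, lev A a ≤ lev A d → a ≤ d → d ∈ Bof (A \ NLrem A (lev A a)) :=
      fun d hd hle had => ⟨⟨hd, fun h => absurd (lev_lt h) (not_lt.2 hle)⟩, fun e he hde =>
        hB.2 e he ⟨had.1.trans_lt hde.1, had.2.trans_lt hde.2⟩⟩
    refine hC ⟨hB, b, hmem b hb hle.1 ⟨h1.le, h2.le⟩, c, hmem c hc hle.2 ⟨h4.le, h3.le⟩, ?_, ?_, ?_⟩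
    · rintro rfl; exact lt_irrefl _ h2
    · rintro rfl; exact lt_irrefl _ h4
    · exact Prod.ext (by simp [← h1, h4.le]) (by simp [← h3, h2.le])

/-- Sets in the positive orthant that avoid `c + ℕ²` have finitely many levels. -/
lemma exists_subset_NLrem {A : Set Z2} {c : Z2} (h0 : A ⊆ orth) (hc : ∀ a ∈ A, ¬ c ≤ a) :
    ∃ N, A ⊆ NLrem A N := by
  have key : ∀ N : ℕ, ∀ a ∈ A, (c.1 - a.1).toNat + (c.2 - a.2).toNat ≤ N → a ∈ NLrem A N := by
    intro N
    induction N with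
    | zero =>
      intro a ha h
      exact absurd ⟨by omega, by omega⟩ (hc a ha)
    | succ N ih =>
      intro a ha h
      have hlt : a.1 < c.1 ∨ a.2 < c.2 := by
        by_contra! hle
        exact hc a ha hle
      by_cases hN : a ∈ NLrem A N
      · exact Or.inl hN
      refine Or.inr ⟨⟨⟨ha, hN⟩, ?_⟩, ?_⟩
      · rintro b ⟨hb, hbN⟩ ⟨h1, h2⟩
        exact hbN (ih b hb (by omega))
      · rintro ⟨-, b, ⟨⟨hb, hbN⟩, -⟩, d, ⟨⟨hd, hdN⟩, -⟩, hba, hda, hmin⟩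
        have e1 : a.1 = min b.1 d.1 := congrArg Prod.fst hmin
        have e2 : a.2 = min b.2 d.2 := congrArg Prod.snd hmin
        have hb' : ¬ (b.1 = a.1 ∧ b.2 = a.2) := fun h => hba (Prod.ext h.1 h.2)
        have hd' : ¬ (d.1 = a.1 ∧ d.2 = a.2) := fun h => hda (Prod.ext h.1 h.2)
        have hb'' := mt (ih b hb) hbN
        have hd'' := mt (ih d hd) hdN
        omega
  refine ⟨c.1.toNat + c.2.toNat, fun a ha => key _ a ha ?_⟩
  have := h0 ha
  have h1 : 0 ≤ a.1 := this.1
  have h2 : 0 ≤ a.2 := this.2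
  omega

/-! ### Gaps and saturated chains -/

lemma gaps_append (E : Set Z2) (P Q : List Bool) (a : Z2) :
    gaps E (P ++ Q) a = gaps E P a + gaps E Q (a.1 + P.count true, a.2 + P.count false) := by
  induction P generalizing a with
  | nil => simp [gaps]
  | cons s P ih =>
    cases s
    · have e : a.2 + 1 + (P.count false : ℤ) = a.2 + ((P.count false + 1 : ℕ) : ℤ) := by
        push_cast; ring
      simp [gaps, ih, e, add_assoc]
    · have e : a.1 + 1 + (P.count true : ℤ) = a.1 + ((P.count true + 1 : ℕ) : ℤ) := by
        push_cast; ring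
      simp [gaps, ih, e, add_assoc]

lemma gaps_square {E : Set Z2} (hE : G3P E) (P : List Bool) (a : Z2) :
    gaps E (true :: false :: P) a = gaps E (false :: true :: P) a := by
  by_cases ha : a ∈ E
  · have h1 : colHit E a := ⟨a.2, le_rfl, ha⟩
    have h2 : rowHit E a := ⟨a.1, le_rfl, ha⟩
    have h3 : rowHit E (a.1 + 1, a.2) ↔ colHit E (a.1, a.2 + 1) := by
      constructor
      · rintro ⟨x, hx, h⟩
        simp only at hx h
        have hne : a.1 ≠ x := by omega
        obtain ⟨e, he, h4, -, h5⟩ := (hE a ha _ h fun h => hne (congrArg Prod.fst h)).2 rfl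
        have h6 := h5 hne
        simp only at h6
        rw [min_eq_left (by omega)] at h6
        exact ⟨e.2, h4, by rwa [← h6]⟩
      · rintro ⟨y, hy, h⟩
        simp only at hy h
        have hne : a.2 ≠ y := by omega
        obtain ⟨e, he, h4, -, h5⟩ := (hE a ha _ h fun h => hne (congrArg Prod.snd h)).1 rfl
        have h6 := h5 hne
        simp only at h6
        rw [min_eq_left (by omega)] at h6
        exact ⟨e.1, h4, by rwa [← h6]⟩
    simp only [gaps]
    split_ifs <;> first | omega | (exfalso; tauto)
  · have h1 : colHit E a ↔ colHit E (a.1, a.2 + 1) := by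
      constructor
      · rintro ⟨y, hy, h⟩
        refine ⟨y, lt_of_le_of_ne hy ?_, h⟩
        rintro rfl
        exact ha h
      · rintro ⟨y, hy, h⟩
        exact ⟨y, (Int.le_add_one le_rfl).trans hy, h⟩
    have h2 : rowHit E a ↔ rowHit E (a.1 + 1, a.2) := by
      constructor
      · rintro ⟨x, hx, h⟩
        refine ⟨x, lt_of_le_of_ne hx ?_, h⟩
        rintro rfl
        exact ha h
      · rintro ⟨x, hx, h⟩
        exact ⟨x, (Int.le_add_one le_rfl).trans hx, h⟩
    simp only [gaps]
    split_ifs <;> first | omega | (exfalso; tauto)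

/-- By property (G3) the number of gaps depends only on the end points of a path. -/
lemma gaps_perm {E : Set Z2} (hE : G3P E) {P Q : List Bool} (h : P.Perm Q) (a : Z2) :
    gaps E P a = gaps E Q a := by
  induction h generalizing a with
  | nil => rfl
  | cons s _ ih => cases s <;> simp [gaps, ih]
  | swap s t P =>
    cases s <;> cases t
    · rfl
    · exact gaps_square hE P a
    · exact (gaps_square hE P a).symm
    · rfl
  | trans _ _ ih1 ih2 => rw [ih1, ih2]

/-- The path that takes `p` steps to the right and then `q` steps up. -/
def hook (p q : ℕ) : List Bool := List.replicate p true ++ List.replicate q false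

/-- The number of gaps of `E` on the way from `a` to `b`. -/
noncomputable def gapsTo (E : Set Z2) (a b : Z2) : ℕ :=
  gaps E (hook (b.1 - a.1).toNat (b.2 - a.2).toNat) a

lemma gapsTo_add {E : Set Z2} (hE : G3P E) {a b c : Z2} (hab : a ≤ b) (hbc : b ≤ c) :
    gapsTo E a c = gapsTo E a b + gapsTo E b c := by
  have h1 := hab.1
  have h2 := hab.2
  have h3 := hbc.1
  have h4 := hbc.2
  have hp : (c.1 - a.1).toNat = (b.1 - a.1).toNat + (c.1 - b.1).toNat := by omega
  have hq : (c.2 - a.2).toNat = (b.2 - a.2).toNat + (c.2 - b.2).toNat := by omega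
  have hperm : (hook (c.1 - a.1).toNat (c.2 - a.2).toNat).Perm
      (hook (b.1 - a.1).toNat (b.2 - a.2).toNat ++ hook (c.1 - b.1).toNat (c.2 - b.2).toNat) := by
    rw [List.perm_iff_count]
    intro s
    cases s <;> simp [hook, List.count_replicate, hp, hq]
  have hb : ((a.1 + (hook (b.1 - a.1).toNat (b.2 - a.2).toNat).count true,
      a.2 + (hook (b.1 - a.1).toNat (b.2 - a.2).toNat).count false) : Z2) = b := by
    apply Prod.ext <;> simp [hook, List.count_replicate] <;> omega
  rw [gapsTo, gaps_perm hE hperm, gaps_append, hb]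
  rfl

lemma gaps_replicate_true {E : Set Z2} (n : ℕ) (a : Z2)
    (h : ∀ i < n, ¬ colHit E (a.1 + i, a.2)) : gaps E (List.replicate n true) a = n := by
  induction n generalizing a with
  | zero => rfl
  | succ n ih =>
    have h0 : ¬ colHit E a := by simpa using h 0 (by omega)
    rw [List.replicate_succ, gaps, if_neg h0, ih, add_comm]
    intro i hi
    have := h (i + 1) (by omega)
    push_cast at this
    rwa [add_comm (i : ℤ) 1, ← add_assoc] at this

lemma gaps_replicate_false {E : Set Z2} (n : ℕ) (a : Z2)
    (h : ∀ i < n, ¬ rowHit E (a.1, a.2 + i)) : gaps E (List.replicate n false) a = n := by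
  have := gaps_replicate_true (E := sw E) n a.swap h
  have e : List.replicate n true = (List.replicate n false).map not := by simp
  rwa [e, gaps_sw] at this

/-- Two elements of `E` with no element of `E` strictly between them. -/
def Consecutive (E : Set Z2) (a b : Z2) : Prop :=
  a < b ∧ ∀ c ∈ E, ¬ (a < c ∧ c < b)

lemma Consecutive.inf_eq {E : Set Z2} (hE : MinClosed E) {a b u : Z2} (hb : b ∈ E)
    (h : Consecutive E a b) (hu : u ∈ E) (hau : a ≤ u) : u ⊓ b = a ∨ b ≤ u := by
  rcases (le_inf hau h.1.le).eq_or_lt with h1 | h1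
  · exact Or.inl h1.symm
  · rcases (inf_le_right : u ⊓ b ≤ b).eq_or_lt with h2 | h2
    · exact Or.inr (inf_eq_right.1 h2)
    · exact (h.2 _ (hE _ hu _ hb) ⟨h1, h2⟩).elim

lemma Consecutive.gapsTo_add_one {E : Set Z2} (hE : MinClosed E) {a b : Z2} (ha : a ∈ E)
    (hb : b ∈ E) (h : Consecutive E a b) :
    (gapsTo E a b : ℤ) + 1 = (b.1 - a.1) + (b.2 - a.2) := by
  have h1 := h.1.le.1
  have h2 := h.1.le.2
  have hne : a.1 < b.1 ∨ a.2 < b.2 := by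
    by_contra! hle
    exact absurd h.1 (not_lt_of_ge hle)
  have hcol : ∀ x, a.1 < x → x < b.1 → ¬ colHit E (x, a.2) := by
    rintro x hx hxb ⟨y, hy, hu⟩
    rcases h.inf_eq hE hb hu ⟨hx.le, hy⟩ with h | h
    · have : min x b.1 = a.1 := congrArg Prod.fst h
      omega
    · exact absurd h.1 (not_le.2 hxb)
  have hrow : ∀ y, a.2 ≤ y → y < b.2 → (a.1 < b.1 ∨ a.2 < y) → ¬ rowHit E (b.1, y) := by
    rintro y hy hyb hlt ⟨x, hx, hu⟩
    simp only at hx hu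
    rcases h.inf_eq hE hb hu ⟨h1.trans hx, hy⟩ with h | h
    · have e1 : min x b.1 = a.1 := congrArg Prod.fst h
      have e2 : min y b.2 = a.2 := congrArg Prod.snd h
      omega
    · exact absurd h.2 (not_le.2 hyb)
  have hrep : ∀ q : ℕ, ∀ y, a.2 ≤ y → y + q = b.2 → (a.1 < b.1 ∨ a.2 < y) →
      gaps E (List.replicate q false) (b.1, y) = q := by
    intro q y hy hq hlt
    refine gaps_replicate_false q _ fun i hi => hrow _ ?_ ?_ ?_ <;> simp only <;> omega
  rw [gapsTo, hook]
  rcases h1.lt_or_eq with h3 | h3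
  · obtain ⟨p, hp⟩ : ∃ p : ℕ, (b.1 - a.1).toNat = p + 1 := ⟨(b.1 - a.1).toNat - 1, by omega⟩
    have hc : colHit E a := ⟨a.2, le_rfl, ha⟩
    have e : a.1 + 1 + (p : ℤ) = b.1 := by omega
    rw [hp, List.replicate_succ, List.cons_append, gaps, if_pos hc, gaps_append,
      gaps_replicate_true]
    · simp only [List.count_replicate_self, List.count_replicate]
      simp only [Bool.true_beq, Bool.false_eq_true, if_false, e, Nat.cast_zero, add_zero]
      rw [hrep _ _ le_rfl (by omega) (Or.inl h3)]
      omega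
    · intro i hi
      exact hcol _ (by simp only; omega) (by simp only; omega)
  · obtain ⟨q, hq⟩ : ∃ q : ℕ, (b.2 - a.2).toNat = q + 1 := ⟨(b.2 - a.2).toNat - 1, by omega⟩
    have hp : (b.1 - a.1).toNat = 0 := by omega
    have hr : rowHit E a := ⟨a.1, le_rfl, ha⟩
    rw [hp, hq, List.replicate_zero, List.nil_append, List.replicate_succ, gaps, if_pos hr, h3,
      hrep q _ (by omega) (by omega) (Or.inr (by omega))]
    omega

lemma IsSatChain.consecutive {E : Set Z2} {n : ℕ} {f : ℕ → Z2} (h : IsSatChain E n f) {i : ℕ}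
    (hi : i < n) : Consecutive E (f i) (f (i + 1)) :=
  ⟨h.2.1 i hi, h.2.2 i hi⟩

lemma gapsTo_add_length {E : Set Z2} (hM : MinClosed E) (hG : G3P E) {n : ℕ} {f : ℕ → Z2}
    (h : IsSatChain E n f) :
    f 0 ≤ f n ∧ (gapsTo E (f 0) (f n) : ℤ) + n = ((f n).1 - (f 0).1) + ((f n).2 - (f 0).2) := by
  induction n with
  | zero => simp [gapsTo, hook, gaps]
  | succ n ih =>
    obtain ⟨hle, heq⟩ := ih ⟨fun i hi => h.1 i (by omega), fun i hi => h.2.1 i (by omega),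
      fun i hi => h.2.2 i (by omega)⟩
    have hc := IsSatChain.consecutive h (Nat.lt_succ_self n)
    have := hc.gapsTo_add_one hM (h.1 n (by omega)) (h.1 _ le_rfl)
    refine ⟨hle.trans hc.1.le, ?_⟩
    rw [gapsTo_add hG hle hc.1.le]
    push_cast
    omega

lemma exists_isSatChain {E : Set Z2} {b : Z2} (hb : b ∈ E) (N : ℕ) :
    ∀ a ∈ E, a ≤ b → (b.1 - a.1) + (b.2 - a.2) ≤ N →
      ∃ n f, IsSatChain E n f ∧ f 0 = a ∧ f n = b := by
  induction N with
  | zero =>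
    intro a ha hab hN
    have h1 := hab.1
    have h2 := hab.2
    have : a = b := Prod.ext (by omega) (by omega)
    exact ⟨0, fun _ => a, ⟨fun _ _ => ha, by simp, by simp⟩, rfl, this⟩
  | succ N ih =>
    intro a ha hab hN
    rcases hab.eq_or_lt with rfl | hlt
    · exact ⟨0, fun _ => a, ⟨fun _ _ => ha, by simp, by simp⟩, rfl, rfl⟩
    have hsize : ∀ {c d : Z2}, c < d → c.1 + c.2 < d.1 + d.2 := by
      intro c d h
      rcases Prod.lt_iff.1 h with ⟨h1, h2⟩ | ⟨h1, h2⟩ <;> omega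
    obtain ⟨c, ⟨hc, hac, hcb⟩, hmin⟩ :=
      (measure fun c : Z2 => (c.1 + c.2 - (a.1 + a.2)).toNat).wf.has_min
        {c | c ∈ E ∧ a < c ∧ c ≤ b} ⟨b, hb, hlt, le_rfl⟩
    obtain ⟨n, f, hf, h0, hn⟩ := ih c hc hcb (by have := hsize hac; omega)
    refine ⟨n + 1, fun i => Nat.casesOn i a f, ⟨?_, ?_, ?_⟩, rfl, hn⟩
    · rintro (_ | i) hi
      · exact ha
      · exact hf.1 i (by omega)
    · rintro (_ | i) hi
      · simpa [h0] using hac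
      · exact hf.2.1 i (by omega)
    · rintro (_ | i) hi d hd ⟨h1, h2⟩
      · replace h1 : a < d := h1
        replace h2 : d < c := h0 ▸ h2
        refine hmin d ⟨hd, h1, h2.le.trans hcb⟩ ?_
        have := hsize h1
        have := hsize h2
        change (d.1 + d.2 - (a.1 + a.2)).toNat < (c.1 + c.2 - (a.1 + a.2)).toNat
        omega
      · exact hf.2.2 i (by omega) d hd ⟨h1, h2⟩

/-- The distance between two elements is the length of any saturated chain joining them. -/
lemma exists_isSatChain_chainDist {E : Set Z2} (hM : MinClosed E) (hG : G3P E) {a b : Z2}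
    (ha : a ∈ E) (hb : b ∈ E) (hab : a ≤ b) :
    ∃ f, IsSatChain E (chainDist E a b) f ∧ f 0 = a ∧ f (chainDist E a b) = b := by
  obtain ⟨n, f, hf, h0, hn⟩ :=
    exists_isSatChain hb ((b.1 - a.1) + (b.2 - a.2)).toNat a ha hab (by omega)
  have : {n : ℕ | ∃ f : ℕ → Z2, IsSatChain E n f ∧ f 0 = a ∧ f n = b} = {n} := by
    refine Set.eq_singleton_iff_unique_mem.2 ⟨⟨f, hf, h0, hn⟩, ?_⟩
    rintro m ⟨g, hg, g0, gm⟩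
    have h1 := (gapsTo_add_length hM hG hf).2
    have h2 := (gapsTo_add_length hM hG hg).2
    rw [h0, hn] at h1
    rw [g0, gm] at h2
    omega
  rw [chainDist, this, csSup_singleton]
  exact ⟨f, hf, h0, hn⟩

lemma chainDist_add_gapsTo {E : Set Z2} (hM : MinClosed E) (hG : G3P E) {a b : Z2}
    (ha : a ∈ E) (hb : b ∈ E) (hab : a ≤ b) :
    (chainDist E a b : ℤ) + gapsTo E a b = (b.1 - a.1) + (b.2 - a.2) := by
  obtain ⟨f, hf, h0, hn⟩ := exists_isSatChain_chainDist hM hG ha hb hab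
  have := (gapsTo_add_length hM hG hf).2
  rw [h0, hn] at this
  omega

/-! ### Genus and length in terms of gaps -/

lemma minEl_eq {E : Set Z2} {e : Z2} (he : IsLeast E e) : minEl E = e :=
  Prod.ext
    (IsLeast.csInf_eq ⟨Set.mem_image_of_mem _ he.1,
      Set.forall_mem_image.2 fun _ h => (he.2 h).1⟩)
    (IsLeast.csInf_eq ⟨Set.mem_image_of_mem _ he.1,
      Set.forall_mem_image.2 fun _ h => (he.2 h).2⟩)

lemma dist2_eq {E F : Set Z2} {β : Z2} {z : ℤ} (hF : ∀ γ, ∃ α ∈ F, γ ≤ α)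
    (h : ∀ α ∈ F, β ≤ α →
      (chainDist E (minEl E) α : ℤ) - (chainDist F (minEl F) α : ℤ) = z) : dist2 E F = z := by
  have : {z : ℤ | ∃ β : Z2, ∀ α ∈ F, β ≤ α →
      (chainDist E (minEl E) α : ℤ) - (chainDist F (minEl F) α : ℤ) = z} = {z} := by
    refine Set.eq_singleton_iff_unique_mem.2 ⟨⟨β, h⟩, ?_⟩
    rintro w ⟨γ, hγ⟩
    obtain ⟨α, hα, hle⟩ := hF (β ⊔ γ)
    rw [← hγ α hα (le_sup_right.trans hle), h α hα (le_sup_left.trans hle)]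
  rw [dist2, this, csSup_singleton]

lemma minClosed_Ici (c : Z2) : MinClosed (Set.Ici c) :=
  fun _ ha _ hb => Set.mem_Ici.2 (le_inf ha hb)

lemma g3P_Ici (c : Z2) : G3P (Set.Ici c) := by
  intro a ha b hb _
  have ha1 := ha.1
  have ha2 := ha.2
  have hb1 := hb.1
  have hb2 := hb.2
  refine ⟨fun _ => ⟨(a.1 + 1, min a.2 b.2), ⟨?_, ?_⟩, ?_, le_rfl, fun _ => rfl⟩,
    fun _ => ⟨(min a.1 b.1, a.2 + 1), ⟨?_, ?_⟩, ?_, le_rfl, fun _ => rfl⟩⟩ <;> simp only <;> omega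

lemma chainDist_Ici {a b c : Z2} (ha : c ≤ a) (hab : a ≤ b) :
    (chainDist (Set.Ici c) a b : ℤ) = (b.1 - a.1) + (b.2 - a.2) := by
  have h0 : gapsTo (Set.Ici c) a b = 0 := gaps_eq_zero _ fun d hd => ha.trans hd
  rw [← chainDist_add_gapsTo (minClosed_Ici c) (g3P_Ici c) ha (ha.trans hab) hab, h0]
  simp

lemma orth_eq : orth = Set.Ici (0 : Z2) := rfl

/-- Every element above the conductor belongs to `S`. -/
lemma mem_of_condE_le {S : Set Z2} (hS : IsGood S) {y : Z2} (hy : condE S ≤ y) : y ∈ S := by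
  obtain ⟨h0, -, -, hM, ⟨δ, hδ⟩, -⟩ := hS
  obtain ⟨γ, hγ, e1⟩ := Int.csInf_mem
    (s := (fun δ : Z2 => δ.1) '' {δ : Z2 | ∀ y : Z2, δ ≤ y → y ∈ S}) ⟨_, δ, hδ, rfl⟩
    ⟨0, Set.forall_mem_image.2 fun γ hγ => (h0 (hγ γ le_rfl)).1⟩
  obtain ⟨ε, hε, e2⟩ := Int.csInf_mem
    (s := (fun δ : Z2 => δ.2) '' {δ : Z2 | ∀ y : Z2, δ ≤ y → y ∈ S}) ⟨_, δ, hδ, rfl⟩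
    ⟨0, Set.forall_mem_image.2 fun γ hγ => (h0 (hγ γ le_rfl)).2⟩
  have h1 : γ.1 ≤ y.1 := e1.trans_le hy.1
  have h2 : ε.2 ≤ y.2 := e2.trans_le hy.2
  have := hM (y.1, max y.2 γ.2) (hγ _ ⟨h1, le_max_right _ _⟩)
    (max y.1 ε.1, y.2) (hε _ ⟨le_max_right _ _, h2⟩)
  rwa [Prod.mk_inf_mk, inf_of_le_left (le_max_left _ _),
    inf_of_le_right (le_max_left _ _)] at this

lemma CIdeal_eq {S : Set Z2} (hS : IsGood S) : CIdeal S = Set.Ici (condE S) :=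
  Set.ext fun _ => ⟨fun h => h.2, fun h => ⟨mem_of_condE_le hS h, h⟩⟩

lemma condE_nonneg {S : Set Z2} (hS : IsGood S) : 0 ≤ condE S :=
  hS.1 (mem_of_condE_le hS le_rfl)

lemma isLeast_zero {S : Set Z2} (hS : IsGood S) : IsLeast S 0 := ⟨hS.2.1, fun _ h => hS.1 h⟩

lemma exists_mem_ge {S : Set Z2} (hS : IsGood S) (γ : Z2) : ∃ α ∈ S, γ ≤ α :=
  ⟨condE S ⊔ γ, mem_of_condE_le hS le_sup_left, le_sup_right⟩

lemma gapsTo_of_condE_le {S : Set Z2} (hS : IsGood S) {α : Z2} (hα : condE S ≤ α) :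
    gapsTo S 0 α = gapsTo S 0 (condE S) := by
  have h0 : gapsTo S (condE S) α = 0 := gaps_eq_zero _ fun d hd => mem_of_condE_le hS hd
  rw [gapsTo_add hS.2.2.2.2.2 (condE_nonneg hS) hα, h0, add_zero]

lemma genus_eq {S : Set Z2} (hS : IsGood S) : genus S = gapsTo S 0 (condE S) := by
  refine dist2_eq (β := condE S) (exists_mem_ge hS) fun α hα hle => ?_
  have := chainDist_add_gapsTo hS.2.2.2.1 hS.2.2.2.2.2 hS.2.1 hα (hS.1 hα)
  rw [gapsTo_of_condE_le hS hle] at this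
  rw [orth_eq, minEl_eq isLeast_Ici, minEl_eq (isLeast_zero hS), chainDist_Ici le_rfl (hS.1 hα)]
  omega

lemma glen_eq {S : Set Z2} (hS : IsGood S) : glen S = chainDist S 0 (condE S) := by
  have hc := condE_nonneg hS
  rw [glen, CIdeal_eq hS]
  refine dist2_eq (β := condE S) (fun γ => ⟨condE S ⊔ γ, Set.mem_Ici.2 le_sup_left, le_sup_right⟩)
    fun α hα _ => ?_
  have h1 := chainDist_add_gapsTo hS.2.2.2.1 hS.2.2.2.2.2 hS.2.1 (mem_of_condE_le hS hα)
    (hc.trans hα)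
  have h2 := chainDist_add_gapsTo hS.2.2.2.1 hS.2.2.2.2.2 hS.2.1 (mem_of_condE_le hS le_rfl) hc
  rw [gapsTo_of_condE_le hS hα] at h1
  rw [minEl_eq isLeast_Ici, minEl_eq (isLeast_zero hS), chainDist_Ici le_rfl hα]
  omega

/-! ### The filtration attached to a saturated chain -/

/-- The elements of the orthant that translate the part of `S` above `a` into `S`. -/
def colon (S : Set Z2) (a : Z2) : Set Z2 := {α | α ∈ orth ∧ ∀ u ∈ S, a ≤ u → α + u ∈ S}

lemma minClosed_colon {S : Set Z2} (hS : IsGood S) (a : Z2) : MinClosed (colon S a) := by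
  rintro α ⟨hα, h1⟩ β ⟨hβ, h2⟩
  refine ⟨minClosed_Ici 0 α hα β hβ, fun u hu hau => ?_⟩
  rw [inf_add]
  exact hS.2.2.2.1 _ (h1 u hu hau) _ (h2 u hu hau)

lemma colon_zero {S : Set Z2} (hS : IsGood S) : colon S 0 = S :=
  Set.ext fun α => ⟨fun h => by simpa using h.2 0 hS.2.1 le_rfl,
    fun h => ⟨hS.1 h, fun u hu _ => hS.2.2.1 α h u hu⟩⟩

lemma colon_mono {S : Set Z2} {a b : Z2} (hab : a ≤ b) : colon S a ⊆ colon S b :=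
  fun _ h => ⟨h.1, fun u hu hbu => h.2 u hu (hab.trans hbu)⟩

lemma mem_colon_condE {S : Set Z2} (hS : IsGood S) {α : Z2} (hα : 0 ≤ α) :
    α ∈ colon S (condE S) :=
  ⟨hα, fun _ _ hu => mem_of_condE_le hS (hu.trans (le_add_of_nonneg_left hα))⟩

/-- A column of `S` that contains an element above the conductor is full from there on. -/
lemma column_full {S : Set Z2} {c : Z2} (hM : MinClosed S) (hG : G3P S)
    (hc : ∀ y, c ≤ y → y ∈ S) {x z w : ℤ} (h : (x, z) ∈ S) (hcz : c.2 ≤ z) (hzw : z ≤ w) :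
    (x, w) ∈ S := by
  rcases hzw.eq_or_lt with rfl | hzw
  · exact h
  have key : ∀ n : ℕ, ∃ v, z + n ≤ v ∧ (x, v) ∈ S := by
    intro n
    induction n with
    | zero => exact ⟨z, by simp, h⟩
    | succ n ih =>
      obtain ⟨v, hv, hvS⟩ := ih
      have hmem : ((max (x + 1) c.1, v) : Z2) ∈ S := hc _ ⟨le_max_right _ _, by simp only; omega⟩
      have hne : x ≠ max (x + 1) c.1 := by omega
      obtain ⟨e, he, h1, -, h2⟩ := (hG _ hvS _ hmem fun h => hne (congrArg Prod.fst h)).2 rfl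
      have h3 := h2 hne
      simp only at h1 h3
      have h4 : e = (x, e.2) := Prod.ext (by simp only; omega) rfl
      exact ⟨e.2, by push_cast; omega, h4 ▸ he⟩
  obtain ⟨v, hv, hvS⟩ := key (w - z).toNat
  have hmem : ((max x c.1, w) : Z2) ∈ S := hc _ ⟨le_max_right _ _, by simp only; omega⟩
  have := hM _ hvS _ hmem
  rwa [Prod.mk_inf_mk, inf_of_le_left (le_max_left _ _), inf_of_le_right (by omega)] at this

/-- A set of integers with an element has one that is maximal or exceeds a given bound. -/
lemma exists_max_or_ge {T : Set ℤ} (hT : T.Nonempty) (c : ℤ) :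
    ∃ s ∈ T, c ≤ s ∨ ∀ u ∈ T, u ≤ s := by
  by_cases h : ∃ s ∈ T, c ≤ s
  · obtain ⟨s, hs, hc⟩ := h
    exact ⟨s, hs, Or.inl hc⟩
  · push Not at h
    have hb : BddAbove T := ⟨c, fun s hs => (h s hs).le⟩
    exact ⟨sSup T, Int.csSup_mem hT hb, Or.inr fun u hu => le_csSup hb hu⟩

lemma exists_witness_of_snd_eq {S : Set Z2} {a b c : Z2} (hM : MinClosed S) (hG : G3P S)
    (hc : ∀ y, c ≤ y → y ∈ S) (ha : a ∈ S) (hb : b ∈ S) (hab : Consecutive S a b)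
    (h1 : a.1 < b.1) (h2 : a.2 = b.2) :
    ∃ σ ∈ S, a ≤ σ ∧ ∀ α : Z2, 0 ≤ α → (∀ u ∈ S, b ≤ u → α + u ∈ S) → α + σ ∈ S →
      ∀ u ∈ S, a ≤ u → α + u ∈ S := by
  have hray : ∀ u ∈ S, a ≤ u → u.1 = a.1 ∨ b ≤ u := by
    intro u hu hau
    rcases hab.inf_eq hM hb hu hau with h | h
    · have : min u.1 b.1 = a.1 := congrArg Prod.fst h
      exact Or.inl (by omega)
    · exact Or.inr h
  obtain ⟨s, ⟨hs, has⟩, hmax⟩ :=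
    exists_max_or_ge (T := {s | (a.1, s) ∈ S ∧ a.2 ≤ s}) ⟨a.2, ha, le_rfl⟩ c.2
  refine ⟨(a.1, s), hs, ⟨le_rfl, has⟩, fun α hα hαb hασ u hu hau => ?_⟩
  rcases hray u hu hau with hua | hbu
  swap
  · exact hαb u hu hbu
  have hα2 : 0 ≤ α.2 := hα.2
  have hue : u = (a.1, u.2) := Prod.ext hua rfl
  rw [hue] at hu ⊢
  rcases lt_trichotomy u.2 s with hlt | heq | hgt
  · obtain ⟨e, he, h3, -, h4⟩ :=
      (hG _ hu _ hs fun h => hlt.ne (congrArg Prod.snd h)).1 rfl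
    have h5 := h4 hlt.ne
    simp only at h3 h5
    have hau2 := hau.2
    have hae : a ≤ e := ⟨h3.le, by omega⟩
    have hbe : b ≤ e := (hray e he hae).resolve_left h3.ne'
    have := hM _ (hαb e he hbe) _ hασ
    have e' : (α + e) ⊓ (α + (a.1, s)) = α + (a.1, u.2) :=
      Prod.ext (by simp; omega) (by simp; omega)
    rwa [e'] at this
  · rwa [heq]
  · have hcs : c.2 ≤ s := hmax.resolve_right fun h => absurd (h u.2 ⟨hu, hau.2⟩) (not_le.2 hgt)
    exact column_full hM hG hc hασ (by simp only; omega)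
      (by simp only; omega)

lemma Consecutive.sw {E : Set Z2} {a b : Z2} (h : Consecutive E a b) :
    Consecutive (sw E) a.swap b.swap :=
  ⟨Prod.swap_lt_swap.2 h.1, fun c hc hlt =>
    h.2 c.swap hc ⟨Prod.swap_lt_swap.1 hlt.1, Prod.swap_lt_swap.1 hlt.2⟩⟩

/-- Let `a` and `b` be consecutive in `S`.  Whether an element of `colon S b` lies in `colon S a`
is decided by its sum with a single element `σ` of `S`. -/
lemma exists_witness {S : Set Z2} {a b c : Z2} (hM : MinClosed S) (hG : G3P S)
    (hc : ∀ y, c ≤ y → y ∈ S) (ha : a ∈ S) (hb : b ∈ S) (hab : Consecutive S a b) :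
    ∃ σ ∈ S, a ≤ σ ∧ ∀ α : Z2, 0 ≤ α → (∀ u ∈ S, b ≤ u → α + u ∈ S) → α + σ ∈ S →
      ∀ u ∈ S, a ≤ u → α + u ∈ S := by
  have hle1 := hab.1.le.1
  have hle2 := hab.1.le.2
  rcases hle2.eq_or_lt with h2 | h2
  · refine exists_witness_of_snd_eq hM hG hc ha hb hab (lt_of_le_of_ne hle1 fun h1 => ?_) h2
    exact hab.1.ne (Prod.ext h1 h2)
  rcases hle1.eq_or_lt with h1 | h1
  · obtain ⟨σ, hσ, haσ, h⟩ := exists_witness_of_snd_eq (c := c.swap) (minClosed_sw hM) (g3P_sw hG)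
      (fun y hy => hc _ ⟨hy.2, hy.1⟩) (a := a.swap) (b := b.swap) ha hb hab.sw h2 h1
    exact ⟨σ.swap, hσ, ⟨haσ.2, haσ.1⟩, fun α hα hαb hασ u hu hau =>
      h α.swap ⟨hα.2, hα.1⟩ (fun v hv hbv => hαb v.swap hv ⟨hbv.2, hbv.1⟩) hασ u.swap hu
        ⟨hau.2, hau.1⟩⟩
  · refine ⟨a, ha, le_rfl, fun α _ hαb hαa u hu hau => ?_⟩
    rcases hab.inf_eq hM hb hu hau with h | h
    · have e1 : min u.1 b.1 = a.1 := congrArg Prod.fst h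
      have e2 : min u.2 b.2 = a.2 := congrArg Prod.snd h
      have : u = a := Prod.ext (by omega) (by omega)
      rwa [this]
    · exact hαb u hu h

lemma IsLabeling.translate {A B : Set Z2} {lab : Z2 → ℕ} (h : IsLabeling A lab) (σ : Z2)
    (hB : ∀ α ∈ B, α + σ ∈ A) : IsLabeling B (fun α => lab (α + σ)) where
  llt_lt a ha b hb hab := h.llt_lt _ (hB a ha) _ (hB b hb)
    ⟨add_lt_add_left hab.1 _, add_lt_add_left hab.2 _⟩
  min_lt a ha b hb c hc h1 h2 h3 h4 := h.min_lt _ (hB a ha) _ (hB b hb) _ (hB c hc)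
    (congrArg (· + σ.1) h1) (add_lt_add_left h2 _) (congrArg (· + σ.2) h3) (add_lt_add_left h4 _)

lemma PFset_subset_NLrem {S : Set Z2} (hS : IsGood S) : PFset S ⊆ NLrem (PFset S) (typ S) :=
  Nat.sInf_mem (exists_subset_NLrem (c := condE S) (fun _ h => h.1)
    fun _ h hle => h.2.1 (mem_of_condE_le hS hle))

lemma dominated_colon {S : Set Z2} (hS : IsGood S) (hl : IsLocal S) {a b : Z2} (ha : a ∈ S)
    (hb : b ∈ S) (hab : Consecutive S a b) (P : List Bool) (x : Z2) :
    Dominated (colon S a) (colon S b) (typ S) P x := by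
  have hM := hS.2.2.2.1
  obtain ⟨σ, hσ, haσ, h⟩ :=
    exists_witness hM hS.2.2.2.2.2 (fun y => mem_of_condE_le hS) ha hb hab
  have hPF : ∀ α ∈ colon S b \ colon S a, α + σ ∈ PFset S := by
    rintro α ⟨⟨h0, hαb⟩, hαa⟩
    refine ⟨add_nonneg (a := α) h0 (hS.1 hσ), fun hασ => hαa ⟨h0, h α h0 hαb hασ⟩,
      fun m hm hm0 => ?_⟩
    rw [add_assoc]
    refine hαb _ (hS.2.2.1 _ hσ _ hm) ?_
    have hm1 : 0 < m.1 := lt_of_le_of_ne (hS.1 hm).1 fun h => hm0 (hl m hm (Or.inl h.symm))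
    have hm2 : 0 < m.2 := lt_of_le_of_ne (hS.1 hm).2 fun h => hm0 (hl m hm (Or.inr h.symm))
    have hσ1 := haσ.1
    have hσ2 := haσ.2
    refine (hab.inf_eq hM hb (hS.2.2.1 _ hσ _ hm)
      (haσ.trans (le_add_of_nonneg_right (hS.1 hm)))).resolve_left fun h => ?_
    have e1 : min (σ.1 + m.1) b.1 = a.1 := congrArg Prod.fst h
    have e2 : min (σ.2 + m.2) b.2 = a.2 := congrArg Prod.snd h
    exact hab.1.ne (Prod.ext (by omega) (by omega))
  have hN := PFset_subset_NLrem hS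
  exact dominated_of_isLabeling (minClosed_colon hS b) (colon_mono hab.1.le)
    ((isLabeling_lev hN).translate σ hPF) _ P x fun α hα _ => lev_lt (hN (hPF α hα))

lemma gaps_le_length_mul_typ {S : Set Z2} (hS : IsGood S) (hl : IsLocal S) {n : ℕ} {f : ℕ → Z2}
    (hf : IsSatChain S n f) (h0 : f 0 = 0) (hn : f n = condE S) (P : List Bool) :
    gaps S P 0 ≤ n * typ S := by
  have key : ∀ i ≤ n, ∃ Q, gaps S P 0 ≤ i * typ S + gaps (colon S (f i)) Q 0 := by
    intro i
    induction i with
    | zero => exact fun _ => ⟨P, by rw [h0, colon_zero hS]; simp⟩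
    | succ i ih =>
      intro hi
      obtain ⟨Q, hQ⟩ := ih (by omega)
      obtain ⟨R, hR⟩ := dominated_colon hS hl (hf.1 i (by omega)) (hf.1 (i + 1) hi)
        (IsSatChain.consecutive hf hi) Q 0
      exact ⟨R, by rw [add_mul, one_mul]; omega⟩
  obtain ⟨Q, hQ⟩ := key n le_rfl
  rwa [hn, gaps_eq_zero Q fun α => mem_colon_condE hS, add_zero] at hQ

end GoodSemigroup

/-- For every local good semigroup `S ⊆ ℕ²`,
`g(S) ≤ t(S)·l(S)`. -/
theorem genus_le_type_mul_length (S : Set Z2) (hS : IsGood S) (hl : IsLocal S) :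
    genus S ≤ (typ S : ℤ) * glen S := by
  have hM := hS.2.2.2.1
  obtain ⟨f, hf, h0, hn⟩ := GoodSemigroup.exists_isSatChain_chainDist hM hS.2.2.2.2.2 hS.2.1
    (GoodSemigroup.mem_of_condE_le hS le_rfl) (GoodSemigroup.condE_nonneg hS)
  rw [GoodSemigroup.genus_eq hS, GoodSemigroup.glen_eq hS, mul_comm]
  exact_mod_cast GoodSemigroup.gaps_le_length_mul_typ hS hl hf h0 hn _
end
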